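/- arXiv:1206.2459 — 3 statements merged into one kernel-verified Lean document; each statement's English description precedes it below -/
import Mathlib

section
/- (Decreasing limits of σ-algebras.) Let P, Q be probability measures on a measurable space (X, 𝓐), let 𝓐 ⊇ 𝓐₁ ⊇ 𝓐₂ ⊇ ⋯ be a decreasing family of sub-σ-algebras, and let 𝓐_∞ = ⋂_{n=1}^∞ 𝓐_n. Let α ∈ [0,∞). If α ∈ [0,1), or if there exists an m such that D_α(P|𝓐_m ‖ Q|𝓐_m) < ∞, then lim_{n→∞} D_α(P|𝓐_n ‖ Q|𝓐_n) = D_α(P|𝓐_∞ ‖ Q|𝓐_∞). -/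
open MeasureTheory Real Filter Set
open scoped ENNReal NNReal Topology Classical

/-- The Hellinger integral `∫ p^α q^(1-α) dμ`, computed with the dominating
measure `μ = P + Q` (the value does not depend on the choice of dominating
measure). The `ℝ≥0∞`-valued `rpow` automatically implements the conventions
`0/0 = 0` and `x/0 = ∞` for `x > 0` when `α > 1`. -/
noncomputable def hellingerInt {X : Type*} [MeasurableSpace X]
    (α : ℝ) (P Q : Measure X) : ℝ≥0∞ :=
  ∫⁻ x, P.rnDeriv (P + Q) x ^ α * Q.rnDeriv (P + Q) x ^ (1 - α) ∂(P + Q)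

/-- Rényi divergence of a simple order `α ∈ (0,1) ∪ (1,∞)`:
`D_α(P‖Q) = (α-1)⁻¹ log ∫ p^α q^(1-α) dμ`. -/
noncomputable def renyiSimple {X : Type*} [MeasurableSpace X]
    (α : ℝ) (P Q : Measure X) : EReal :=
  (((α - 1)⁻¹ : ℝ) : EReal) * ENNReal.log (hellingerInt α P Q)

/-- Rényi divergence of any order `α ∈ [0,∞]`.  The extended orders `0`, `1`, `∞`
are defined as the limits of the simple orders (the limits exist by monotonicity
in the order, so they coincide with the `limsup`s used here). -/
noncomputable def renyiDiv {X : Type*} [MeasurableSpace X]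
    (α : ℝ≥0∞) (P Q : Measure X) : EReal :=
  if α = 0 then Filter.limsup (fun a : ℝ => renyiSimple a P Q) (nhdsWithin (0:ℝ) (Set.Ioi 0))
  else if α = 1 then Filter.limsup (fun a : ℝ => renyiSimple a P Q) (nhdsWithin (1:ℝ) (Set.Iio 1))
  else if α = ∞ then Filter.limsup (fun a : ℝ => renyiSimple a P Q) Filter.atTop
  else renyiSimple α.toReal P Q

/-- Kullback-Leibler divergence `D(P‖Q) = ∫ p log (p/q) dμ`, with the conventions
`0 log (0/q) = 0` and `p log (p/0) = ∞` for `p > 0`; in particular `D(P‖Q) = ∞`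
whenever `P` is not absolutely continuous w.r.t. `Q`, or the integral diverges. -/
noncomputable def klDiv {X : Type*} [MeasurableSpace X] (P Q : Measure X) : EReal :=
  if P ≪ Q ∧ Integrable (llr P Q) P then ((∫ x, llr P Q x ∂P : ℝ) : EReal) else ⊤

set_option linter.unusedSectionVars false

lemma aux_proj_antitone {E : Type*} [NormedAddCommGroup E] [InnerProductSpace ℝ E] [CompleteSpace E]
    (K : ℕ → Submodule ℝ E) [∀ n, (K n).HasOrthogonalProjection] (hK : Antitone K)
    (L : Submodule ℝ E) [L.HasOrthogonalProjection] (hL : L = ⨅ n, K n) (x : E) :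
    Tendsto (fun n => (K n).starProjection x) atTop (𝓝 (L.starProjection x)) := by
  have h := Submodule.starProjection_tendsto_closure_iSup (fun n => (K n)ᗮ)
    (fun a b hab => Submodule.orthogonal_le (hK hab)) x
  have hM : (⨆ n, (K n)ᗮ).topologicalClosure = Lᗮ := by
    rw [← Submodule.orthogonal_orthogonal_eq_closure, ← Submodule.iInf_orthogonal, hL]
    simp [Submodule.orthogonal_orthogonal]
  simp only [hM] at h
  simp only [Submodule.starProjection_orthogonal_val] at h
  have h2 := h.const_sub x
  simpa using h2

lemma aux_aesm_iInf {X : Type*} {mX : MeasurableSpace X} (μ : Measure X)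
    (𝔉 : ℕ → MeasurableSpace X) (hanti : Antitone 𝔉) (f : X → ℝ)
    (hf : ∀ n, AEStronglyMeasurable[𝔉 n] f μ) : AEStronglyMeasurable[⨅ n, 𝔉 n] f μ := by
  choose g hg hfg using hf
  refine ⟨fun x => limsup (fun n => (g n x)) atTop, ?_, ?_⟩
  · refine Measurable.stronglyMeasurable ?_
    intro s hs
    rw [MeasurableSpace.measurableSet_iInf]
    intro k
    have : (fun x => limsup (fun n => (g n x)) atTop) =
      (fun x => limsup (fun n => (g (n + k) x)) atTop) := by
      ext x
      exact (limsup_nat_add (fun n => g n x) k).symm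
    rw [this]
    have hm : Measurable[𝔉 k] (fun x => limsup (fun n => (g (n + k) x)) atTop) := by
      refine Measurable.limsup ?_
      intro i
      exact (hg (i+k)).measurable.mono (hanti (by omega)) le_rfl
    exact hm hs
  · filter_upwards [ae_all_iff.2 hfg] with x hx
    simp [← hx]

lemma aux_downward {X : Type*} {mX : MeasurableSpace X} (μ : Measure X) [IsFiniteMeasure μ]
    (𝔉 : ℕ → MeasurableSpace X) (hanti : Antitone 𝔉) (hle : ∀ n, 𝔉 n ≤ mX)
    (u : X → ℝ) (hu : MemLp u 2 μ) :
    TendstoInMeasure μ (fun n => μ[u | 𝔉 n]) atTop (μ[u | ⨅ n, 𝔉 n]) := by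
  have hle' : (⨅ n, 𝔉 n) ≤ mX := (iInf_le 𝔉 0).trans (hle 0)
  have (n : ℕ) : Fact (𝔉 n ≤ mX) := ⟨hle n⟩
  have : Fact ((⨅ n, 𝔉 n) ≤ mX) := ⟨hle'⟩
  have key := aux_proj_antitone (fun n => lpMeas ℝ ℝ (𝔉 n) 2 μ)
    (by
      intro a b hab f hf
      rw [mem_lpMeas_iff_aestronglyMeasurable] at hf ⊢
      exact hf.mono (hanti hab)) (lpMeas ℝ ℝ (⨅ n, 𝔉 n) 2 μ)
    (by
      ext f
      simp only [Submodule.mem_iInf, mem_lpMeas_iff_aestronglyMeasurable]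
      exact ⟨fun h n => h.mono (iInf_le 𝔉 n), fun h => aux_aesm_iInf μ 𝔉 hanti f h⟩) hu.toLp
  have h2 := tendstoInMeasure_of_tendsto_Lp key
  refine (h2.congr_left (fun n => ?_)).congr_right ?_
  · exact hu.condExpL2_ae_eq_condExp (𝕜 := ℝ) (hle n)
  · exact hu.condExpL2_ae_eq_condExp (𝕜 := ℝ) hle'

noncomputable def phiR (α t : ℝ) : ℝ≥0∞ := ENNReal.ofReal t ^ α * ENNReal.ofReal (1 - t) ^ (1 - α)

lemma measurable_phiR (α : ℝ) : Measurable (phiR α) := by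
  unfold phiR; fun_prop

noncomputable def eR {X : Type*} {mX : MeasurableSpace X} (P Q : Measure X)
    (m : MeasurableSpace X) : X → ℝ := (P + Q)[fun x => (P.rnDeriv (P + Q) x).toReal | m]

section
variable {X : Type*} {m mX : MeasurableSpace X} (P Q : Measure X)
    [IsProbabilityMeasure P] [IsProbabilityMeasure Q]

lemma aux_sum_one : ∀ᵐ x ∂(P + Q), (Q.rnDeriv (P + Q) x).toReal = 1 - (P.rnDeriv (P + Q) x).toReal := by
  have h := Measure.rnDeriv_add P Q (P + Q)
  have h' := Measure.rnDeriv_self (P + Q)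
  filter_upwards [h, h', Measure.rnDeriv_ne_top P (P+Q), Measure.rnDeriv_ne_top Q (P+Q)]
    with x h1 h2 h3 h4
  rw [h1, Pi.add_apply] at h2
  have := congrArg ENNReal.toReal h2
  rw [ENNReal.toReal_add h3 h4] at this
  simp at this
  linarith

lemma aux_le_one : ∀ᵐ x ∂(P + Q), (P.rnDeriv (P + Q) x).toReal ≤ 1 := by
  filter_upwards [aux_sum_one P Q] with x hx
  have : 0 ≤ (Q.rnDeriv (P + Q) x).toReal := ENNReal.toReal_nonneg
  linarith

lemma eR_meas : StronglyMeasurable[m] (eR P Q m) := stronglyMeasurable_condExp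

lemma eR_integrable : Integrable (eR P Q m) (P + Q) := integrable_condExp

lemma eR_nonneg : ∀ᵐ x ∂(P + Q), 0 ≤ eR P Q m x :=
  condExp_nonneg (Eventually.of_forall fun _ => ENNReal.toReal_nonneg)

lemma eR_le_one (hm : m ≤ mX) : ∀ᵐ x ∂(P + Q), eR P Q m x ≤ 1 := by
  have := condExp_mono (m := m) (Measure.integrable_toReal_rnDeriv) (integrable_const (1:ℝ)) (aux_le_one P Q)
  rw [condExp_const hm] at this
  exact this

lemma eR_integral (hm : m ≤ mX) : ∫ x, eR P Q m x ∂(P + Q) = 1 := by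
  unfold eR
  rw [integral_condExp hm, Measure.integral_toReal_rnDeriv]
  · simp
  · exact Measure.AbsolutelyContinuous.rfl.add_right Q

lemma eR_tower {m' : MeasurableSpace X} (hm' : m' ≤ m) (hm : m ≤ mX) :
    (P + Q)[eR P Q m | m'] =ᵐ[P + Q] eR P Q m' :=
  condExp_condExp_of_le hm' hm

lemma hell_eq (hm : m ≤ mX) (α : ℝ) :
    @hellingerInt X m α (P.trim hm) (Q.trim hm) = ∫⁻ x, phiR α (eR P Q m x) ∂(P + Q) := by
  have htr : P.trim hm + Q.trim hm = (P + Q).trim hm := by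
    refine @Measure.ext _ m _ _ fun s hs => ?_
    rw [Measure.add_apply, trim_measurableSet_eq hm hs, trim_measurableSet_eq hm hs,
      trim_measurableSet_eq hm hs, Measure.add_apply]
  have hP : P ≪ P + Q := Measure.AbsolutelyContinuous.rfl.add_right Q
  have hQ : Q ≪ P + Q := by
    rw [add_comm]; exact Measure.AbsolutelyContinuous.rfl.add_right P
  unfold hellingerInt
  rw [htr, lintegral_trim hm]
  · refine lintegral_congr_ae ?_
    have h3 : (P + Q)[fun x => (Q.rnDeriv (P + Q) x).toReal | m] =ᵐ[P + Q] fun x => 1 - eR P Q m x := by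
      have h4 := condExp_congr_ae (m := m) (aux_sum_one P Q)
      have h5 := condExp_sub (integrable_const (μ := P + Q) (1:ℝ)) (Measure.integrable_toReal_rnDeriv (μ := P) (ν := P + Q)) m
      refine h4.trans (h5.trans ?_)
      rw [condExp_const hm]
      rfl
    filter_upwards [ae_eq_of_ae_eq_trim (rnDeriv_trim hm hP), ae_eq_of_ae_eq_trim (rnDeriv_trim hm hQ), h3]
      with x h1 h2 h3
    rw [h1, h2, h3]
    rfl
  · exact ((Measure.measurable_rnDeriv _ _).pow_const _).mul ((Measure.measurable_rnDeriv _ _).pow_const _)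

lemma aux_zero (μ : Measure X) [IsFiniteMeasure μ] (hm : m ≤ mX) (v : X → ℝ) (hv : Integrable v μ)
    (hv0 : ∀ᵐ x ∂μ, 0 ≤ v x) : ∀ᵐ x ∂μ, (μ[v | m]) x = 0 → v x = 0 := by
  have hs : MeasurableSet[m] {x | (μ[v | m]) x = 0} :=
    (stronglyMeasurable_condExp (f := v) (m := m) (μ := μ)).measurable (measurableSet_singleton 0)
  have h := setIntegral_condExp hm hv hs
  have h0 : ∫ x in {x | (μ[v | m]) x = 0}, (μ[v | m]) x ∂μ = 0 := by
    rw [setIntegral_congr_fun (hm _ hs) (g := fun _ => (0:ℝ)) (fun x hx => hx)]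
    simp
  rw [h0] at h
  have h' := (setIntegral_eq_zero_iff_of_nonneg_ae (ae_restrict_of_ae hv0) hv.integrableOn).1 h.symm
  exact (ae_restrict_iff' (hm _ hs)).1 h'

lemma eR_tendsto (𝔉 : ℕ → MeasurableSpace X) (hanti : Antitone 𝔉) (hle : ∀ n, 𝔉 n ≤ mX) :
    TendstoInMeasure (P + Q) (fun n => eR P Q (𝔉 n)) atTop (eR P Q (⨅ n, 𝔉 n)) := by
  refine aux_downward (P + Q) 𝔉 hanti hle _ ?_
  refine MemLp.of_bound (Measure.measurable_rnDeriv _ _).ennreal_toReal.aestronglyMeasurable 1 ?_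
  filter_upwards [aux_le_one P Q] with x hx
  rw [Real.norm_of_nonneg ENNReal.toReal_nonneg]
  exact hx

end
section
variable {X : Type*} {mX : MeasurableSpace X} (P Q : Measure X)
    [IsProbabilityMeasure P] [IsProbabilityMeasure Q]

lemma aux_jensen {m m' : MeasurableSpace X} (hm' : m' ≤ m) (hm : m ≤ mX) (g c d : ℝ → ℝ)
    (htan : ∀ t, 0 ≤ t → t < 1 → ∀ a, 0 < a → c a * (1 - t) + d a * t ≤ g t)
    (hlim : ∀ t, 0 ≤ t → t < 1 →
      Tendsto (fun a => c a * (1 - t) + d a * t) (𝓝[>] (t / (1 - t))) (𝓝 (g t)))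
    (hint : Integrable (fun x => g (eR P Q m x)) (P + Q))
    (hlt : ∀ᵐ x ∂(P + Q), eR P Q m x < 1) :
    ∀ᵐ x ∂(P + Q), eR P Q m' x < 1 ∧
      g (eR P Q m' x) ≤ ((P + Q)[fun x => g (eR P Q m x) | m']) x := by
  have hi : Integrable (eR P Q m) (P + Q) := eR_integrable P Q
  have htow := eR_tower P Q hm' hm
  have hc : ∀ k l : ℝ, (P + Q)[fun x => k * (1 - eR P Q m x) + l * eR P Q m x | m'] =ᵐ[P + Q]
      fun x => k * (1 - eR P Q m' x) + l * eR P Q m' x := by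
    intro k l
    have e1 : (fun x => k * (1 - eR P Q m x) + l * eR P Q m x) =
        (fun _ => k) + (l - k) • eR P Q m := by
      ext x; simp; ring
    rw [e1]
    have h1 := condExp_add (m := m') (integrable_const (μ := P + Q) k) (hi.smul (l - k))
    have h2 := condExp_smul (μ := P + Q) (l - k) (eR P Q m) m'
    rw [condExp_const (hm'.trans hm)] at h1
    filter_upwards [h1, h2, htow] with x h1 h2 h3
    rw [h1, Pi.add_apply, h2, Pi.smul_apply, h3, smul_eq_mul]
    ring
  have hz := aux_zero (P + Q) (hm'.trans hm) (fun x => 1 - eR P Q m x) ((integrable_const 1).sub hi)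
    (by filter_upwards [hlt] with x hx; linarith)
  have hlt' : ∀ᵐ x ∂(P + Q), eR P Q m' x < 1 := by
    filter_upwards [hz, hc 1 0, hlt, eR_le_one P Q (hm'.trans hm)] with x h1 h2 h3 h4
    simp only [one_mul, zero_mul, add_zero] at h2
    rw [h2] at h1
    rcases lt_or_eq_of_le h4 with h | h
    · exact h
    · have := h1 (by rw [h]; ring)
      linarith
  have hall : ∀ᵐ x ∂(P + Q), ∀ q : ℚ, 0 < (q : ℝ) →
      c q * (1 - eR P Q m' x) + d q * eR P Q m' x ≤ ((P + Q)[fun x => g (eR P Q m x) | m']) x := by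
    rw [ae_all_iff]
    intro q
    by_cases hq : 0 < (q : ℝ)
    · have h1 : (P + Q)[fun x => c q * (1 - eR P Q m x) + d q * eR P Q m x | m'] ≤ᵐ[P + Q]
          (P + Q)[fun x => g (eR P Q m x) | m'] := by
        refine condExp_mono ?_ hint ?_
        · exact (((integrable_const 1).sub hi).const_mul _).add (hi.const_mul _)
        · filter_upwards [hlt, eR_nonneg P Q (m := m)] with x h1 h2
          exact htan _ h2 h1 _ hq
      filter_upwards [h1, hc (c q) (d q)] with x h1 h2 _
      rw [← h2]; exact h1
    · exact Eventually.of_forall fun x h => absurd h hq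
  filter_upwards [hall, hlt', eR_nonneg P Q (m := m')] with x h1 h2 h3
  refine ⟨h2, ?_⟩
  obtain ⟨u, -, hu1, hu2⟩ := Real.exists_seq_rat_strictAnti_tendsto (eR P Q m' x / (1 - eR P Q m' x))
  have hu3 : Tendsto (fun n => (u n : ℝ)) atTop (𝓝[>] (eR P Q m' x / (1 - eR P Q m' x))) :=
    tendsto_nhdsWithin_iff.2 ⟨hu2, Eventually.of_forall hu1⟩
  refine le_of_tendsto ((hlim _ h3 h2).comp hu3) (Eventually.of_forall fun n => h1 _ ?_)
  exact lt_of_le_of_lt (div_nonneg h3 (by linarith)) (hu1 n)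

lemma aux_vitali {m mi : MeasurableSpace X} (hm : m ≤ mX) (𝔊 : ℕ → MeasurableSpace X)
    (h𝔊 : ∀ n, 𝔊 n ≤ m) (hmi : mi ≤ m)
    (hT : TendstoInMeasure (P + Q) (fun n => eR P Q (𝔊 n)) atTop (eR P Q mi))
    (G : ℝ → ℝ≥0∞) (g c d : ℝ → ℝ) (hGm : Measurable G)
    (hG : ∀ t, 0 ≤ t → t < 1 → G t = ENNReal.ofReal (g t)) (hG1 : G 1 = ⊤)
    (hgm : Measurable g) (hg0 : ∀ t, 0 ≤ t → t < 1 → 0 ≤ g t) (hgc : ContinuousOn g (Ico 0 1))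
    (htan : ∀ t, 0 ≤ t → t < 1 → ∀ a, 0 < a → c a * (1 - t) + d a * t ≤ g t)
    (hlim : ∀ t, 0 ≤ t → t < 1 →
      Tendsto (fun a => c a * (1 - t) + d a * t) (𝓝[>] (t / (1 - t))) (𝓝 (g t)))
    (hfin : ∫⁻ x, G (eR P Q m x) ∂(P + Q) < ⊤) :
    Tendsto (fun n => ∫⁻ x, G (eR P Q (𝔊 n) x) ∂(P + Q)) atTop
      (𝓝 (∫⁻ x, G (eR P Q mi x) ∂(P + Q))) := by
  have hmeas : ∀ m' : MeasurableSpace X, m' ≤ mX → Measurable[mX] (eR P Q m') := fun m' h =>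
    (eR_meas P Q (m := m')).measurable.mono h le_rfl
  have hlt : ∀ᵐ x ∂(P + Q), eR P Q m x < 1 := by
    filter_upwards [ae_lt_top (hGm.comp (hmeas m hm)) hfin.ne, eR_le_one P Q hm] with x h1 h2
    refine lt_of_le_of_ne h2 fun h => ?_
    simp [h, hG1] at h1
  have hof : ∀ m' : MeasurableSpace X, m' ≤ m → (∀ᵐ x ∂(P + Q), eR P Q m' x < 1) →
      ∫⁻ x, G (eR P Q m' x) ∂(P + Q) = ∫⁻ x, ENNReal.ofReal (g (eR P Q m' x)) ∂(P + Q) := by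
    intro m' _ hl
    refine lintegral_congr_ae ?_
    filter_upwards [hl, eR_nonneg P Q (m := m')] with x h1 h2 using hG _ h2 h1
  have hint : Integrable (fun x => g (eR P Q m x)) (P + Q) := by
    refine ⟨(hgm.comp (hmeas m hm)).aestronglyMeasurable, ?_⟩
    rw [hasFiniteIntegral_iff_ofReal]
    · rw [← hof m le_rfl hlt]; exact hfin
    · filter_upwards [hlt, eR_nonneg P Q (m := m)] with x h1 h2 using hg0 _ h2 h1
  have hJ := fun (m' : MeasurableSpace X) (h : m' ≤ m) =>
    aux_jensen P Q h hm g c d htan hlim hint hlt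
  have hgi : ∀ m' : MeasurableSpace X, m' ≤ m → Integrable (fun x => g (eR P Q m' x)) (P + Q) := by
    intro m' h
    refine Integrable.mono' (g := (P + Q)[fun x => g (eR P Q m x) | m']) integrable_condExp
      (hgm.comp (hmeas m' (h.trans hm))).aestronglyMeasurable ?_
    filter_upwards [hJ m' h, eR_nonneg P Q (m := m')] with x h1 h2
    rw [Real.norm_of_nonneg (hg0 _ h2 h1.1)]
    exact h1.2
  have hint_eq : ∀ m' : MeasurableSpace X, m' ≤ m →
      ∫⁻ x, G (eR P Q m' x) ∂(P + Q) = ENNReal.ofReal (∫ x, g (eR P Q m' x) ∂(P + Q)) := by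
    intro m' h
    have hl : ∀ᵐ x ∂(P + Q), eR P Q m' x < 1 := (hJ m' h).mono fun x hx => hx.1
    rw [hof m' h hl, ofReal_integral_eq_lintegral_ofReal (hgi m' h)]
    filter_upwards [hl, eR_nonneg P Q (m := m')] with x h1 h2 using hg0 _ h2 h1
  rw [hint_eq mi hmi]
  simp_rw [fun n => hint_eq (𝔊 n) (h𝔊 n)]
  refine ENNReal.tendsto_ofReal ?_
  refine tendsto_of_subseq_tendsto fun ns hns => ?_
  obtain ⟨ms, _, hms⟩ := (hT.comp hns).exists_seq_tendsto_ae
  refine ⟨ms, ?_⟩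
  refine tendsto_integral_of_L1' _ (hgi mi hmi).1 (Eventually.of_forall fun k => hgi _ (h𝔊 _)) ?_
  refine tendsto_Lp_finite_of_tendsto_ae le_rfl ENNReal.one_ne_top (fun k => (hgi _ (h𝔊 _)).1)
    (memLp_one_iff_integrable.2 (hgi mi hmi)) ?_ ?_
  · have hui := (hint.uniformIntegrable_condExp (fun n => (h𝔊 n).trans hm)).2.1
    intro ε hε
    obtain ⟨δ, hδ, H⟩ := hui hε
    refine ⟨δ, hδ, fun k s hs hμs => le_trans ?_ (H (ns (ms k)) s hs hμs)⟩
    refine eLpNorm_mono_ae ?_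
    filter_upwards [hJ _ (h𝔊 (ns (ms k))), eR_nonneg P Q (m := 𝔊 (ns (ms k)))] with x h1 h2
    by_cases hx : x ∈ s
    · simp only [indicator_of_mem hx]
      rw [Real.norm_of_nonneg (hg0 _ h2 h1.1)]
      exact h1.2.trans (le_abs_self _)
    · simp [indicator_of_notMem hx]
  · have hl := ae_all_iff.2 (fun k => hJ _ (h𝔊 (ns (ms k))))
    have hn := ae_all_iff.2 (fun k => eR_nonneg P Q (m := 𝔊 (ns (ms k))))
    filter_upwards [hms, hl, hn, hJ _ hmi, eR_nonneg P Q (m := mi)] with x h1 h2 h3 h4 h5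
    refine (hgc _ ⟨h5, h4.1⟩).tendsto.comp (tendsto_nhdsWithin_iff.2 ⟨h1, ?_⟩)
    exact Eventually.of_forall fun k => ⟨h3 k, (h2 k).1⟩

end
lemma tan_rpow {α : ℝ} (hα : 1 < α) {r a : ℝ} (hr : 0 ≤ r) (ha : 0 < a) :
    (1 - α) * a ^ α + α * a ^ (α - 1) * r ≤ r ^ α := by
  have h := one_add_mul_self_le_rpow_one_add (s := r / a - 1) (by have := div_nonneg hr ha.le; linarith)
    hα.le
  have e : 1 + (r / a - 1) = r / a := by ring
  rw [e, Real.div_rpow hr ha.le] at h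
  have hp : 0 < a ^ α := Real.rpow_pos_of_pos ha _
  rw [le_div_iff₀ hp] at h
  rw [Real.rpow_sub_one ha.ne']
  refine le_trans (le_of_eq ?_) h
  field_simp
  ring

lemma tan_kl {r a : ℝ} (hr : 0 ≤ r) (ha : 0 < a) :
    (1 - a) + log a * r ≤ InformationTheory.klFun r := by
  unfold InformationTheory.klFun
  rcases hr.eq_or_lt with rfl | hr
  · simp; exact ha.le
  · have h := Real.log_le_sub_one_of_pos (div_pos ha hr)
    rw [Real.log_div ha.ne' hr.ne'] at h
    have h2 := mul_le_mul_of_nonneg_left h hr.le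
    have e : r * (a / r - 1) = a - r := by field_simp
    rw [e] at h2
    linarith

noncomputable def kG (t : ℝ) : ℝ≥0∞ :=
  if t < 1 then ENNReal.ofReal ((1 - t) * InformationTheory.klFun (t / (1 - t))) else ⊤

lemma measurable_kg : Measurable fun t : ℝ => (1 - t) * InformationTheory.klFun (t / (1 - t)) := by
  have := InformationTheory.measurable_klFun
  fun_prop

lemma measurable_kG : Measurable kG := by
  unfold kG
  exact Measurable.ite measurableSet_Iio measurable_kg.ennreal_ofReal measurable_const

lemma g_rpow_eq {α t : ℝ} (ht : 0 ≤ t) (ht1 : t < 1) :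
    t ^ α * (1 - t) ^ (1 - α) = (1 - t) * (t / (1 - t)) ^ α := by
  have h : 0 < 1 - t := by linarith
  rw [Real.div_rpow ht h.le, Real.rpow_sub h, Real.rpow_one]
  ring

section
variable {X : Type*} {mX : MeasurableSpace X} (P Q : Measure X)
    [IsProbabilityMeasure P] [IsProbabilityMeasure Q]

lemma conv_kl {m mi : MeasurableSpace X} (hm : m ≤ mX) (𝔊 : ℕ → MeasurableSpace X)
    (h𝔊 : ∀ n, 𝔊 n ≤ m) (hmi : mi ≤ m)
    (hT : TendstoInMeasure (P + Q) (fun n => eR P Q (𝔊 n)) atTop (eR P Q mi))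
    (hfin : ∫⁻ x, kG (eR P Q m x) ∂(P + Q) < ⊤) :
    Tendsto (fun n => ∫⁻ x, kG (eR P Q (𝔊 n) x) ∂(P + Q)) atTop
      (𝓝 (∫⁻ x, kG (eR P Q mi x) ∂(P + Q))) := by
  refine aux_vitali P Q hm 𝔊 h𝔊 hmi hT kG (fun t => (1 - t) * InformationTheory.klFun (t / (1 - t)))
    (fun a => 1 - a) (fun a => log a) measurable_kG ?_ ?_ measurable_kg ?_ ?_ ?_ ?_ hfin
  · intro t _ h; simp [kG, h]
  · simp [kG]
  · intro t h0 h1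
    have h : 0 < 1 - t := by linarith
    exact mul_nonneg h.le (InformationTheory.klFun_nonneg (div_nonneg h0 h.le))
  · refine ContinuousOn.mul (by fun_prop) ?_
    refine InformationTheory.continuous_klFun.comp_continuousOn (continuousOn_id.div (by fun_prop) ?_)
    intro t ht
    have := ht.2
    intro h
    linarith
  · intro t h0 h1 a ha
    have h : 0 < 1 - t := by linarith
    have h2 := mul_le_mul_of_nonneg_left (tan_kl (div_nonneg h0 h.le) ha) h.le
    refine le_trans (le_of_eq ?_) h2
    field_simp
  · intro t h0 h1
    have h : 0 < 1 - t := by linarith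
    rcases h0.eq_or_lt with rfl | h0
    · simp only [sub_zero, mul_one, mul_zero, add_zero, one_mul, zero_div, InformationTheory.klFun_zero]
      refine tendsto_nhdsWithin_of_tendsto_nhds ?_
      have : Continuous fun a : ℝ => 1 - a := by fun_prop
      simpa using this.tendsto 0
    · have hr : 0 < t / (1 - t) := div_pos h0 h
      refine tendsto_nhdsWithin_of_tendsto_nhds ?_
      have hc : ContinuousAt (fun a : ℝ => (1 - a) * (1 - t) + log a * t) (t / (1 - t)) := by
        have := Real.continuousAt_log hr.ne'
        fun_prop
      convert! hc.tendsto using 2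
      unfold InformationTheory.klFun
      field_simp
      ring

lemma conv_gt {α : ℝ} (hα : 1 < α) {m mi : MeasurableSpace X} (hm : m ≤ mX)
    (𝔊 : ℕ → MeasurableSpace X)
    (h𝔊 : ∀ n, 𝔊 n ≤ m) (hmi : mi ≤ m)
    (hT : TendstoInMeasure (P + Q) (fun n => eR P Q (𝔊 n)) atTop (eR P Q mi))
    (hfin : ∫⁻ x, phiR α (eR P Q m x) ∂(P + Q) < ⊤) :
    Tendsto (fun n => ∫⁻ x, phiR α (eR P Q (𝔊 n) x) ∂(P + Q)) atTop
      (𝓝 (∫⁻ x, phiR α (eR P Q mi x) ∂(P + Q))) := by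
  refine aux_vitali P Q hm 𝔊 h𝔊 hmi hT (phiR α) (fun t => t ^ α * (1 - t) ^ (1 - α))
    (fun a => (1 - α) * a ^ α) (fun a => α * a ^ (α - 1)) (measurable_phiR α) ?_ ?_ ?_ ?_ ?_ ?_ ?_ hfin
  · intro t h0 h1
    have h : 0 < 1 - t := by linarith
    rw [phiR, ENNReal.ofReal_mul (Real.rpow_nonneg h0 _),
      ENNReal.ofReal_rpow_of_nonneg h0 (by linarith), ENNReal.ofReal_rpow_of_pos h]
  · have : 1 - α < 0 := by linarith
    simp [phiR, ENNReal.zero_rpow_of_neg this]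
  · fun_prop
  · intro t h0 h1
    have h : 0 < 1 - t := by linarith
    exact mul_nonneg (Real.rpow_nonneg h0 _) (Real.rpow_nonneg h.le _)
  · refine ContinuousOn.mul ?_ ?_
    · exact (Real.continuous_rpow_const (by linarith)).continuousOn
    · refine ContinuousOn.rpow_const (by fun_prop) ?_
      intro t ht
      left
      have := ht.2
      intro h
      linarith
  · intro t h0 h1 a ha
    have h : 0 < 1 - t := by linarith
    have h2 := mul_le_mul_of_nonneg_left (tan_rpow hα (div_nonneg h0 h.le) ha) h.le
    rw [g_rpow_eq h0 h1]
    refine le_trans (le_of_eq ?_) h2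
    field_simp
  · intro t h0 h1
    have h : 0 < 1 - t := by linarith
    rw [g_rpow_eq h0 h1]
    refine tendsto_nhdsWithin_of_tendsto_nhds ?_
    have hc : Continuous (fun a : ℝ => (1 - α) * a ^ α * (1 - t) + α * a ^ (α - 1) * t) := by
      have h1 : Continuous fun a : ℝ => a ^ α := Real.continuous_rpow_const (by linarith)
      have h2 : Continuous fun a : ℝ => a ^ (α - 1) := Real.continuous_rpow_const (by linarith)
      fun_prop
    convert! hc.tendsto _ using 2
    rcases h0.eq_or_lt with rfl | h0
    · simp [Real.zero_rpow (show α ≠ 0 by linarith)]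
    · have hr : 0 < t / (1 - t) := div_pos h0 h
      rw [Real.rpow_sub_one hr.ne']
      field_simp
      ring
end
lemma phiR_le_one {α t : ℝ} (h0 : 0 ≤ α) (h1 : α ≤ 1) (ht0 : 0 ≤ t) (ht1 : t ≤ 1) : phiR α t ≤ 1 := by
  unfold phiR
  refine mul_le_one' (ENNReal.rpow_le_one ?_ h0) (ENNReal.rpow_le_one ?_ (by linarith))
  · exact ENNReal.ofReal_le_one.2 ht1
  · exact ENNReal.ofReal_le_one.2 (by linarith)

lemma continuous_phiR {α : ℝ} (h0 : 0 ≤ α) (h1 : α ≤ 1) : Continuous (phiR α) := by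
  rw [continuous_iff_continuousAt]
  intro t
  have e1 : Continuous fun t : ℝ => ENNReal.ofReal t ^ α :=
    ENNReal.continuous_rpow_const.comp ENNReal.continuous_ofReal
  have e2 : Continuous fun t : ℝ => ENNReal.ofReal (1 - t) ^ (1 - α) :=
    ENNReal.continuous_rpow_const.comp (ENNReal.continuous_ofReal.comp (by fun_prop))
  refine ENNReal.Tendsto.mul (e1.tendsto t) (Or.inr ?_) (e2.tendsto t) (Or.inr ?_)
  · exact ENNReal.rpow_ne_top_of_nonneg (by linarith) ENNReal.ofReal_ne_top
  · exact ENNReal.rpow_ne_top_of_nonneg h0 ENNReal.ofReal_ne_top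

noncomputable def psiR (t : ℝ) : ℝ≥0∞ := if 0 < t then ENNReal.ofReal (1 - t) else 0

lemma measurable_psiR : Measurable psiR := by
  unfold psiR
  exact Measurable.ite measurableSet_Ioi (by fun_prop) measurable_const

lemma psiR_le_one {t : ℝ} : psiR t ≤ 1 := by
  unfold psiR
  split_ifs
  · exact ENNReal.ofReal_le_one.2 (by linarith)
  · exact zero_le_one

section
variable {X : Type*} {mX : MeasurableSpace X} (μ : Measure X) [IsFiniteMeasure μ]

lemma dom_one (F : ℕ → X → ℝ≥0∞) (f : X → ℝ≥0∞) (hF : ∀ n, Measurable (F n))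
    (h1 : ∀ n, ∀ᵐ x ∂μ, F n x ≤ 1) (hl : ∀ᵐ x ∂μ, Tendsto (fun n => F n x) atTop (𝓝 (f x))) :
    Tendsto (fun n => ∫⁻ x, F n x ∂μ) atTop (𝓝 (∫⁻ x, f x ∂μ)) :=
  tendsto_lintegral_of_dominated_convergence (fun _ => 1) hF h1 (by simp) hl

lemma dom_one_filter {l : Filter ℝ} [l.IsCountablyGenerated] (F : ℝ → X → ℝ≥0∞) (f : X → ℝ≥0∞)
    (hF : ∀ n, Measurable (F n))
    (h1 : ∀ᶠ n in l, ∀ᵐ x ∂μ, F n x ≤ 1) (hl : ∀ᵐ x ∂μ, Tendsto (fun n => F n x) l (𝓝 (f x))) :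
    Tendsto (fun n => ∫⁻ x, F n x ∂μ) l (𝓝 (∫⁻ x, f x ∂μ)) :=
  tendsto_lintegral_filter_of_dominated_convergence (fun _ => 1) (Eventually.of_forall hF) h1
    (by simp) hl
end

section
variable {X : Type*} {mX : MeasurableSpace X} (P Q : Measure X)
    [IsProbabilityMeasure P] [IsProbabilityMeasure Q]

lemma eR_measurable {m : MeasurableSpace X} (hm : m ≤ mX) : Measurable[mX] (eR P Q m) :=
  (eR_meas P Q (m := m)).measurable.mono hm le_rfl

lemma conv_bdd {mi : MeasurableSpace X} (hmi : mi ≤ mX)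
    (𝔊 : ℕ → MeasurableSpace X) (h𝔊 : ∀ n, 𝔊 n ≤ mX)
    (hT : TendstoInMeasure (P + Q) (fun n => eR P Q (𝔊 n)) atTop (eR P Q mi))
    (G : ℝ → ℝ≥0∞) (hGm : Measurable G) (hG : ∀ t, 0 ≤ t → t ≤ 1 → G t ≤ 1)
    (hc : ∀ᵐ x ∂(P + Q), ∀ ks : ℕ → ℕ,
      Tendsto (fun k => eR P Q (𝔊 (ks k)) x) atTop (𝓝 (eR P Q mi x)) →
      Tendsto (fun k => G (eR P Q (𝔊 (ks k)) x)) atTop (𝓝 (G (eR P Q mi x)))) :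
    Tendsto (fun n => ∫⁻ x, G (eR P Q (𝔊 n) x) ∂(P + Q)) atTop
      (𝓝 (∫⁻ x, G (eR P Q mi x) ∂(P + Q))) := by
  refine tendsto_of_subseq_tendsto fun ns hns => ?_
  obtain ⟨ms, _, hms⟩ := (hT.comp hns).exists_seq_tendsto_ae
  refine ⟨ms, ?_⟩
  refine dom_one (P + Q) _ _
    (fun k => hGm.comp (eR_measurable P Q (h𝔊 _))) (fun k => ?_) ?_
  · filter_upwards [eR_nonneg P Q (m := 𝔊 (ns (ms k))), eR_le_one P Q (h𝔊 (ns (ms k)))] with x h1 h2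
    exact hG _ h1 h2
  · filter_upwards [hc, hms] with x h1 h2
    exact h1 (fun k => ns (ms k)) h2

lemma conv_lt {α : ℝ} (h0 : 0 ≤ α) (h1 : α ≤ 1) {mi : MeasurableSpace X} (hmi : mi ≤ mX)
    (𝔊 : ℕ → MeasurableSpace X) (h𝔊 : ∀ n, 𝔊 n ≤ mX)
    (hT : TendstoInMeasure (P + Q) (fun n => eR P Q (𝔊 n)) atTop (eR P Q mi)) :
    Tendsto (fun n => ∫⁻ x, phiR α (eR P Q (𝔊 n) x) ∂(P + Q)) atTop
      (𝓝 (∫⁻ x, phiR α (eR P Q mi x) ∂(P + Q))) := by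
  refine conv_bdd P Q hmi 𝔊 h𝔊 hT _ (measurable_phiR α) (fun t => phiR_le_one h0 h1) ?_
  exact Eventually.of_forall fun x ks h => ((continuous_phiR h0 h1).tendsto _).comp h

lemma conv_zero {mi : MeasurableSpace X} 
    (𝔊 : ℕ → MeasurableSpace X) (h𝔊 : ∀ n, 𝔊 n ≤ mX) (hmi : ∀ n, mi ≤ 𝔊 n)
    (hT : TendstoInMeasure (P + Q) (fun n => eR P Q (𝔊 n)) atTop (eR P Q mi)) :
    Tendsto (fun n => ∫⁻ x, psiR (eR P Q (𝔊 n) x) ∂(P + Q)) atTop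
      (𝓝 (∫⁻ x, psiR (eR P Q mi x) ∂(P + Q))) := by
  have hmi' : mi ≤ mX := (hmi 0).trans (h𝔊 0)
  refine conv_bdd P Q hmi' 𝔊 h𝔊 hT _ measurable_psiR (fun t _ _ => psiR_le_one) ?_
  have hz : ∀ᵐ x ∂(P + Q), ∀ n, eR P Q mi x = 0 → eR P Q (𝔊 n) x = 0 := by
    rw [ae_all_iff]
    intro n
    filter_upwards [aux_zero (P + Q) hmi' (eR P Q (𝔊 n)) (eR_integrable P Q) (eR_nonneg P Q),
      eR_tower P Q (hmi n) (h𝔊 n)] with x h1 h2 h3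
    exact h1 (h2.trans h3)
  filter_upwards [hz, eR_nonneg P Q (m := mi)] with x h1 h2 ks h3
  rcases h2.eq_or_lt with h2 | h2
  · simp [h1 _ h2.symm, ← h2]
  · have : ∀ᶠ k in atTop, 0 < eR P Q (𝔊 (ks k)) x := h3.eventually_const_lt h2
    have hc : Tendsto (fun k => ENNReal.ofReal (1 - eR P Q (𝔊 (ks k)) x)) atTop
        (𝓝 (ENNReal.ofReal (1 - eR P Q mi x))) := ENNReal.tendsto_ofReal (h3.const_sub 1)
    have e : psiR (eR P Q mi x) = ENNReal.ofReal (1 - eR P Q mi x) := by simp [psiR, h2]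
    rw [e]
    refine hc.congr' ?_
    filter_upwards [this] with k hk
    simp [psiR, hk]

lemma lim_zero {m : MeasurableSpace X} (hm : m ≤ mX) :
    Tendsto (fun a => ∫⁻ x, phiR a (eR P Q m x) ∂(P + Q)) (𝓝[>] 0)
      (𝓝 (∫⁻ x, psiR (eR P Q m x) ∂(P + Q))) := by
  have hev : ∀ᶠ a : ℝ in 𝓝[>] 0, 0 < a ∧ a < 1 := Ioo_mem_nhdsGT one_pos
  refine dom_one_filter (P + Q) _ _ ?_ ?_ ?_
  · exact fun a => (measurable_phiR a).comp (eR_measurable P Q hm)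
  · filter_upwards [hev] with a ha
    filter_upwards [eR_nonneg P Q (m := m), eR_le_one P Q hm] with x h1 h2
    exact phiR_le_one ha.1.le ha.2.le h1 h2
  · filter_upwards [eR_nonneg P Q (m := m), eR_le_one P Q hm] with x h1 h2
    generalize eR P Q m x = t at h1 h2
    rcases h1.eq_or_lt with rfl | h1
    · refine tendsto_const_nhds.congr' ?_
      filter_upwards [hev] with a ha
      simp [psiR, phiR, ENNReal.zero_rpow_of_pos ha.1]
    · have hid : Tendsto (fun a : ℝ => a) (𝓝[>] 0) (𝓝 0) := tendsto_nhdsWithin_of_tendsto_nhds tendsto_id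
      rw [show psiR t = 1 * ENNReal.ofReal (1 - t) by simp [psiR, h1]]
      refine ENNReal.Tendsto.mul ?_ (by simp) ?_ (by simp)
      · have h3 := ENNReal.tendsto_ofReal ((Real.continuousAt_const_rpow h1.ne').tendsto.comp hid)
        simp only [Real.rpow_zero, ENNReal.ofReal_one] at h3
        refine h3.congr fun a => ?_
        simp [ENNReal.ofReal_rpow_of_pos h1]
      · rcases h2.eq_or_lt with rfl | h2
        · refine tendsto_const_nhds.congr' ?_
          filter_upwards [hev] with a ha
          have : 0 < 1 - a := by linarith [ha.2]
          simp [ENNReal.zero_rpow_of_pos this]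
        · have hp : 0 < 1 - t := by linarith
          have h3 := ENNReal.tendsto_ofReal ((Real.continuousAt_const_rpow (b := 1 - 0) hp.ne').tendsto.comp
            (hid.const_sub 1))
          simp only [sub_zero, Real.rpow_one] at h3
          refine h3.congr fun a => ?_
          simp [ENNReal.ofReal_rpow_of_pos hp]
end
noncomputable def fR (a t : ℝ) : ℝ := a * t + (1 - a) * (1 - t) - t ^ a * (1 - t) ^ (1 - a)

lemma fR_nonneg {a t : ℝ} (h0 : 0 < a) (h1 : a < 1) (ht0 : 0 ≤ t) (ht1 : t ≤ 1) : 0 ≤ fR a t := by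
  have := Real.geom_mean_le_arith_mean2_weighted (w₁ := a) (w₂ := 1 - a) (p₁ := t) (p₂ := 1 - t)
    h0.le (by linarith) ht0 (by linarith) (by ring)
  unfold fR
  linarith

lemma fR_eq {a t : ℝ} (h1 : a < 1) (ht0 : 0 < t) (ht1 : t < 1) :
    fR a t / (1 - a) = (1 - 2 * t) - t * ((((1 - t) / t) ^ (1 - a) - 1) / (1 - a)) := by
  have hb : 0 < 1 - a := by linarith
  have hq : 0 < 1 - t := by linarith
  have e1 : t ^ a = t / t ^ (1 - a) := by
    rw [eq_div_iff (Real.rpow_pos_of_pos ht0 _).ne', ← Real.rpow_add ht0]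
    simp
  have hp := (Real.rpow_pos_of_pos ht0 (1 - a)).ne'
  rw [fR, e1, Real.div_rpow hq.le ht0.le]
  field_simp
  ring

lemma kg_eq {t : ℝ} (ht0 : 0 < t) (ht1 : t < 1) :
    (1 - t) * InformationTheory.klFun (t / (1 - t)) = (1 - 2 * t) - t * log ((1 - t) / t) := by
  have hq : 0 < 1 - t := by linarith
  unfold InformationTheory.klFun
  rw [Real.log_div ht0.ne' hq.ne', Real.log_div hq.ne' ht0.ne']
  field_simp
  ring

lemma fR_le_kG {a t : ℝ} (h0 : 0 < a) (h1 : a < 1) (ht0 : 0 ≤ t) (ht1 : t ≤ 1) :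
    ENNReal.ofReal (fR a t / (1 - a)) ≤ kG t := by
  have hb : 0 < 1 - a := by linarith
  rcases ht1.eq_or_lt with rfl | ht1
  · simp [kG]
  rw [kG, if_pos ht1]
  refine ENNReal.ofReal_le_ofReal ?_
  rcases ht0.eq_or_lt with rfl | ht0
  · simp [fR, Real.zero_rpow h0.ne', div_self hb.ne', InformationTheory.klFun_zero]
  rw [fR_eq h1 ht0 ht1, kg_eq ht0 ht1]
  have hs : 0 < (1 - t) / t := div_pos (by linarith) ht0
  have : log ((1 - t) / t) ≤ (((1 - t) / t) ^ (1 - a) - 1) / (1 - a) := by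
    rw [le_div_iff₀ hb, Real.rpow_def_of_pos hs]
    have := Real.add_one_le_exp (log ((1 - t) / t) * (1 - a))
    linarith
  have := mul_le_mul_of_nonneg_left this ht0.le
  linarith

lemma tend_one_sub : Tendsto (fun a : ℝ => 1 - a) (𝓝[<] 1) (𝓝[>] 0) := by
  refine tendsto_nhdsWithin_iff.2 ⟨?_, ?_⟩
  · refine tendsto_nhdsWithin_of_tendsto_nhds ?_
    have : Continuous fun a : ℝ => 1 - a := by fun_prop
    simpa using this.tendsto 1
  · filter_upwards [self_mem_nhdsWithin] with a ha
    simpa using ha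

lemma fR_tendsto {t : ℝ} (ht0 : 0 ≤ t) (ht1 : t ≤ 1) :
    Tendsto (fun a => ENNReal.ofReal (fR a t / (1 - a))) (𝓝[<] 1) (𝓝 (kG t)) := by
  have hev : ∀ᶠ a : ℝ in 𝓝[<] 1, 0 < a ∧ a < 1 := Ioo_mem_nhdsLT one_pos
  rcases ht1.eq_or_lt with rfl | ht1
  · rw [show kG 1 = ⊤ by simp [kG]]
    refine ENNReal.tendsto_ofReal_nhds_top.2 ?_
    have h1 : Tendsto (fun a : ℝ => (1 - a)⁻¹) (𝓝[<] 1) atTop := tendsto_inv_nhdsGT_zero.comp tend_one_sub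
    have h2 : Tendsto (fun a : ℝ => (1 - a)⁻¹ - 1) (𝓝[<] 1) atTop := tendsto_atTop_add_const_right _ _ h1
    refine h2.congr' ?_
    filter_upwards [hev] with a ha
    have hb : 0 < 1 - a := by linarith [ha.2]
    simp [fR, Real.zero_rpow hb.ne']
    field_simp
    ring
  rw [kG, if_pos ht1]
  refine ENNReal.tendsto_ofReal ?_
  rcases ht0.eq_or_lt with rfl | ht0
  · refine tendsto_const_nhds.congr' ?_
    filter_upwards [hev] with a ha
    have hb : 0 < 1 - a := by linarith [ha.2]
    simp [fR, Real.zero_rpow ha.1.ne', div_self hb.ne', InformationTheory.klFun_zero]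
  · rw [kg_eq ht0 ht1]
    have hs : 0 < (1 - t) / t := div_pos (by linarith) ht0
    have hd := (Real.hasStrictDerivAt_const_rpow hs 0).hasDerivAt
    rw [hasDerivAt_iff_tendsto_slope_zero] at hd
    simp only [zero_add, Real.rpow_zero, one_mul, smul_eq_mul] at hd
    have h2 := hd.comp (tend_one_sub.mono_right (nhdsWithin_mono _ (fun x hx => ne_of_gt hx)))
    refine ((h2.const_mul t).const_sub (1 - 2 * t)).congr' ?_
    filter_upwards [hev] with a ha
    rw [fR_eq ha.2 ht0 ht1]
    simp only [Function.comp]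
    ring

section
variable {X : Type*} {mX : MeasurableSpace X} (P Q : Measure X)
    [IsProbabilityMeasure P] [IsProbabilityMeasure Q]

lemma lim_one_gen (e : X → ℝ) (hem : Measurable e) (hei : Integrable e (P + Q))
    (he0 : ∀ᵐ x ∂(P + Q), 0 ≤ e x) (he1 : ∀ᵐ x ∂(P + Q), e x ≤ 1)
    (hI : ∫ x, e x ∂(P + Q) = 1) :
    Tendsto (fun a : ℝ => (((a - 1)⁻¹ : ℝ) : EReal) *
        ENNReal.log (∫⁻ x, phiR a (e x) ∂(P + Q))) (𝓝[<] 1)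
      (𝓝 ((∫⁻ x, kG (e x) ∂(P + Q) : ℝ≥0∞) : EReal)) := by
  have hev : ∀ᶠ a : ℝ in 𝓝[<] 1, 0 < a ∧ a < 1 := Ioo_mem_nhdsLT one_pos
  have hI2 : ∫ x, (1 - e x) ∂(P + Q) = 1 := by
    rw [integral_sub (integrable_const 1) hei, hI]
    simp [measureReal_add_apply]
  have hc : ∀ a : ℝ, Integrable (fun x => (1 - a) * (1 - e x)) (P + Q) := fun a =>
    ((integrable_const 1).sub hei).const_mul (1 - a)
  let w : ℝ → X → ℝ := fun a x => e x ^ a * (1 - e x) ^ (1 - a)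
  let h : ℝ → ℝ := fun a => ∫ x, w a x ∂(P + Q)
  have hwm : ∀ a, Measurable (w a) := fun a => by fun_prop
  have hw0 : ∀ a, ∀ᵐ x ∂(P + Q), 0 ≤ w a x := fun a => by
    filter_upwards [he0, he1] with x h0 h1
    exact mul_nonneg (Real.rpow_nonneg h0 _) (Real.rpow_nonneg (by linarith) _)
  have hwi : ∀ a, 0 < a → a < 1 → Integrable (w a) (P + Q) := fun a ha ha1 => by
    refine Integrable.mono' (integrable_const 1) (hwm a).aestronglyMeasurable ?_
    filter_upwards [he0, he1, hw0 a] with x h0 h1 h2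
    rw [Real.norm_of_nonneg h2]
    exact mul_le_one₀ (Real.rpow_le_one h0 h1 ha.le) (Real.rpow_nonneg (by linarith) _)
      (Real.rpow_le_one (by linarith) (by linarith) (by linarith))
  have hH : ∀ a, 0 < a → a < 1 → ∫⁻ x, phiR a (e x) ∂(P + Q) = ENNReal.ofReal (h a) := by
    intro a ha ha1
    rw [ofReal_integral_eq_lintegral_ofReal (hwi a ha ha1) (hw0 a)]
    refine lintegral_congr_ae ?_
    filter_upwards [he0, he1] with x h0 h1
    rw [phiR, ENNReal.ofReal_mul (Real.rpow_nonneg h0 _),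
      ENNReal.ofReal_rpow_of_nonneg h0 ha.le,
      ENNReal.ofReal_rpow_of_nonneg (by linarith) (by linarith)]
  have hh0 : ∀ a, 0 ≤ h a := fun a => integral_nonneg_of_ae (hw0 a)
  have hfI : ∀ a, 0 < a → a < 1 → ∫⁻ x, ENNReal.ofReal (fR a (e x) / (1 - a)) ∂(P + Q) =
      ENNReal.ofReal ((1 - h a) / (1 - a)) := by
    intro a ha ha1
    have i1 : Integrable (fun x => a * e x + (1 - a) * (1 - e x)) (P + Q) :=
      (hei.const_mul a).add (((integrable_const 1).sub hei).const_mul (1 - a))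
    have i2 : Integrable (fun x => fR a (e x)) (P + Q) := i1.sub (hwi a ha ha1)
    have e1 : ∫ x, fR a (e x) ∂(P + Q) = 1 - h a := by
      have : (fun x => fR a (e x)) = fun x => (a * e x + (1 - a) * (1 - e x)) - w a x := rfl
      rw [this, integral_sub i1 (hwi a ha ha1), integral_add (hei.const_mul a) (hc a), integral_const_mul, integral_const_mul,
        hI, hI2]
      ring
    rw [← e1, ← integral_div, ofReal_integral_eq_lintegral_ofReal (i2.div_const _)]
    filter_upwards [he0, he1] with x h0 h1
    exact div_nonneg (fR_nonneg ha ha1 h0 h1) (by linarith)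
  set K := ∫⁻ x, kG (e x) ∂(P + Q) with hK
  have hX : Tendsto (fun a => ENNReal.ofReal ((1 - h a) / (1 - a))) (𝓝[<] 1) (𝓝 K) := by
    have hX' : Tendsto (fun a => ∫⁻ x, ENNReal.ofReal (fR a (e x) / (1 - a)) ∂(P + Q)) (𝓝[<] 1) (𝓝 K) := by
      refine tendsto_of_le_liminf_of_limsup_le ?_ ?_
      · refine le_trans (le_of_eq ?_) (lintegral_liminf_le fun a => ?_)
        · refine lintegral_congr_ae ?_
          filter_upwards [he0, he1] with x h0 h1
          exact (fR_tendsto h0 h1).liminf_eq.symm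
        · unfold fR; fun_prop
      · refine limsup_le_of_le (by isBoundedDefault) ?_
        filter_upwards [hev] with a ha
        refine lintegral_mono_ae ?_
        filter_upwards [he0, he1] with x h0 h1
        exact fR_le_kG ha.1 ha.2 h0 h1
    refine hX'.congr' ?_
    filter_upwards [hev] with a ha using hfI a ha.1 ha.2
  have hlow : ∀ᶠ a : ℝ in 𝓝[<] 1, ((ENNReal.ofReal ((1 - h a) / (1 - a)) : ℝ≥0∞) : EReal) ≤
      (((a - 1)⁻¹ : ℝ) : EReal) * ENNReal.log (∫⁻ x, phiR a (e x) ∂(P + Q)) := by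
    filter_upwards [hev] with a ha
    rw [hH a ha.1 ha.2]
    have hb : 0 < 1 - a := by linarith [ha.2]
    have hle1 : h a ≤ 1 := by
      have : 0 ≤ ∫ x, fR a (e x) ∂(P + Q) := by
        refine integral_nonneg_of_ae ?_
        filter_upwards [he0, he1] with x h0 h1 using fR_nonneg ha.1 ha.2 h0 h1
      have i1 : Integrable (fun x => a * e x + (1 - a) * (1 - e x)) (P + Q) :=
        (hei.const_mul a).add (((integrable_const 1).sub hei).const_mul (1 - a))
      have e2 : (fun x => fR a (e x)) = fun x => (a * e x + (1 - a) * (1 - e x)) - w a x := rfl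
      rw [e2, integral_sub i1 (hwi a ha.1 ha.2), integral_add (hei.const_mul a) (hc a), integral_const_mul, integral_const_mul,
        hI, hI2] at this
      change 0 ≤ a * 1 + (1 - a) * 1 - h a at this
      linarith
    rcases (hh0 a).eq_or_lt with h0 | h0
    · rw [← h0]
      simp only [ENNReal.ofReal_zero, ENNReal.log_zero]
      rw [EReal.coe_mul_bot_of_neg (inv_lt_zero.2 (by linarith [ha.2]))]
      exact le_top
    · rw [ENNReal.log_ofReal_of_pos h0, ← EReal.coe_mul,
        EReal.coe_ennreal_ofReal, EReal.coe_le_coe_iff, max_eq_left (div_nonneg (by linarith) hb.le)]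
      have hl := Real.log_le_sub_one_of_pos h0
      have e3 : (a - 1)⁻¹ * log (h a) = (- log (h a)) / (1 - a) := by
        rw [show a - 1 = -(1 - a) by ring, inv_neg]; field_simp
      rw [e3]
      exact div_le_div_of_nonneg_right (by linarith) hb.le
  have hXE : Tendsto (fun a => ((ENNReal.ofReal ((1 - h a) / (1 - a)) : ℝ≥0∞) : EReal)) (𝓝[<] 1)
      (𝓝 (K : EReal)) := (continuous_coe_ennreal_ereal.tendsto K).comp hX
  by_cases hKt : K = ⊤
  · rw [hKt] at hXE ⊢
    exact tendsto_of_tendsto_of_tendsto_of_le_of_le' hXE tendsto_const_nhds hlow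
      (Eventually.of_forall fun a => le_top)
  · have hxm : Tendsto (fun a => max ((1 - h a) / (1 - a)) 0) (𝓝[<] 1) (𝓝 K.toReal) := by
      have := (ENNReal.tendsto_toReal hKt).comp hX
      refine this.congr fun a => ?_
      simp [ENNReal.toReal_ofReal']
    have hb0 : Tendsto (fun a : ℝ => 1 - a) (𝓝[<] 1) (𝓝 0) :=
      tendsto_nhds_of_tendsto_nhdsWithin tend_one_sub
    have hl1 : Tendsto (fun a => 1 - (1 - a) * max ((1 - h a) / (1 - a)) 0) (𝓝[<] 1) (𝓝 1) := by
      have := (hb0.mul hxm).const_sub 1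
      simpa using this
    have hup : Tendsto (fun a => max ((1 - h a) / (1 - a)) 0 /
        (1 - (1 - a) * max ((1 - h a) / (1 - a)) 0)) (𝓝[<] 1) (𝓝 K.toReal) := by
      have := hxm.div hl1 one_ne_zero
      rw [div_one] at this
      exact this
    have hupE : Tendsto (fun a => ((max ((1 - h a) / (1 - a)) 0 /
        (1 - (1 - a) * max ((1 - h a) / (1 - a)) 0) : ℝ) : EReal)) (𝓝[<] 1) (𝓝 (K : EReal)) := by
      rw [← ENNReal.ofReal_toReal hKt, EReal.coe_ennreal_ofReal, max_eq_left ENNReal.toReal_nonneg]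
      exact (continuous_coe_real_ereal.tendsto _).comp hup
    refine tendsto_of_tendsto_of_tendsto_of_le_of_le' hXE hupE hlow ?_
    filter_upwards [hev, hl1.eventually_const_lt zero_lt_one] with a ha hpos
    have hb : 0 < 1 - a := by linarith [ha.2]
    rw [hH a ha.1 ha.2]
    set y := max ((1 - h a) / (1 - a)) 0 with hy
    have hyle : (1 - h a) ≤ (1 - a) * y := by
      have : (1 - h a) / (1 - a) ≤ y := le_max_left _ _
      rw [div_le_iff₀ hb] at this
      linarith
    have hha : 0 < h a := by linarith
    rw [ENNReal.log_ofReal_of_pos hha, ← EReal.coe_mul, EReal.coe_le_coe_iff]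
    have e3 : (a - 1)⁻¹ * log (h a) = (- log (h a)) / (1 - a) := by
      rw [show a - 1 = -(1 - a) by ring, inv_neg]; field_simp
    rw [e3, div_le_div_iff₀ hb hpos]
    have hmono : log (1 - (1 - a) * y) ≤ log (h a) := Real.log_le_log hpos (by linarith)
    have hinv := Real.one_sub_inv_le_log_of_pos hpos
    have h5 : - log (h a) ≤ (1 - (1 - a) * y)⁻¹ - 1 := by linarith
    have h6 := mul_le_mul_of_nonneg_right h5 hpos.le
    refine h6.trans (le_of_eq ?_)
    field_simp
    ring

lemma lim_one {m : MeasurableSpace X} (hm : m ≤ mX) :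
    Tendsto (fun a : ℝ => (((a - 1)⁻¹ : ℝ) : EReal) *
        ENNReal.log (∫⁻ x, phiR a (eR P Q m x) ∂(P + Q))) (𝓝[<] 1)
      (𝓝 ((∫⁻ x, kG (eR P Q m x) ∂(P + Q) : ℝ≥0∞) : EReal)) :=
  lim_one_gen P Q _ (eR_measurable P Q hm) (eR_integrable P Q) (eR_nonneg P Q)
    (eR_le_one P Q hm) (eR_integral P Q hm)
end
section
variable {X : Type*} {mX : MeasurableSpace X} (P Q : Measure X)
    [IsProbabilityMeasure P] [IsProbabilityMeasure Q]

lemma simple_eq {m : MeasurableSpace X} (hm : m ≤ mX) (α : ℝ) :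
    @renyiSimple X m α (P.trim hm) (Q.trim hm) = (((α - 1)⁻¹ : ℝ) : EReal) *
        ENNReal.log (∫⁻ x, phiR α (eR P Q m x) ∂(P + Q)) := by
  rw [renyiSimple, hell_eq P Q hm α]

lemma div_zero_eq {m : MeasurableSpace X} (hm : m ≤ mX) :
    @renyiDiv X m 0 (P.trim hm) (Q.trim hm) = ((-1 : ℝ) : EReal) *
        ENNReal.log (∫⁻ x, psiR (eR P Q m x) ∂(P + Q)) := by
  rw [renyiDiv, if_pos rfl]
  refine Tendsto.limsup_eq ?_
  simp only [simple_eq P Q hm]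
  have hc : Tendsto (fun a : ℝ => (((a - 1)⁻¹ : ℝ) : EReal)) (𝓝[>] 0) (𝓝 ((-1 : ℝ) : EReal)) := by
    refine (continuous_coe_real_ereal.tendsto _).comp ?_
    refine tendsto_nhdsWithin_of_tendsto_nhds ?_
    have : ContinuousAt (fun a : ℝ => (a - 1)⁻¹) 0 := by
      refine ContinuousAt.inv₀ (by fun_prop) (by norm_num)
    have h2 := this.tendsto
    norm_num at h2
    exact h2
  have hne : ((-1 : ℝ) : EReal) ≠ 0 := by
    rw [← EReal.coe_zero, Ne, EReal.coe_eq_coe_iff]; norm_num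
  refine EReal.Tendsto.mul hc ((ENNReal.continuous_log.tendsto _).comp (lim_zero P Q hm))
    (Or.inl hne) (Or.inl hne) (Or.inl (EReal.coe_ne_bot _)) (Or.inl (EReal.coe_ne_top _))

lemma div_one_eq {m : MeasurableSpace X} (hm : m ≤ mX) :
    @renyiDiv X m 1 (P.trim hm) (Q.trim hm) =
      ((∫⁻ x, kG (eR P Q m x) ∂(P + Q) : ℝ≥0∞) : EReal) := by
  rw [renyiDiv, if_neg one_ne_zero, if_pos rfl]
  refine Tendsto.limsup_eq ?_
  simp only [simple_eq P Q hm]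
  exact lim_one P Q hm

lemma div_simple_eq {m : MeasurableSpace X} (hm : m ≤ mX) {α : ℝ≥0∞} (h0 : α ≠ 0) (h1 : α ≠ 1)
    (ht : α ≠ ⊤) :
    @renyiDiv X m α (P.trim hm) (Q.trim hm) = (((α.toReal - 1)⁻¹ : ℝ) : EReal) *
        ENNReal.log (∫⁻ x, phiR α.toReal (eR P Q m x) ∂(P + Q)) := by
  rw [renyiDiv, if_neg h0, if_neg h1, if_neg ht, simple_eq P Q hm]

lemma tendsto_log_mul {u : ℕ → ℝ≥0∞} {v : ℝ≥0∞} {c : ℝ} (hc : c ≠ 0)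
    (h : Tendsto u atTop (𝓝 v)) :
    Tendsto (fun n => (c : EReal) * ENNReal.log (u n)) atTop (𝓝 ((c : EReal) * ENNReal.log v)) := by
  have hne : (c : EReal) ≠ 0 := by
    rw [← EReal.coe_zero, Ne, EReal.coe_eq_coe_iff]; exact hc
  exact EReal.Tendsto.mul tendsto_const_nhds ((ENNReal.continuous_log.tendsto _).comp h)
    (Or.inl hne) (Or.inl hne) (Or.inl (EReal.coe_ne_bot _)) (Or.inl (EReal.coe_ne_top _))
end

/-- **Decreasing limits of σ-algebras.** If `mX ≥ 𝔉 0 ≥ 𝔉 1 ≥ ⋯` is a decreasing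
family of sub-σ-algebras with intersection `⨅ n, 𝔉 n`, and if `α ∈ [0,1)` or
`D_α(P|𝔉 m ‖ Q|𝔉 m) < ∞` for some `m`, then for every `α ∈ [0,∞)`,
`D_α(P|𝔉 n ‖ Q|𝔉 n) → D_α(P|⨅ n, 𝔉 n ‖ Q|⨅ n, 𝔉 n)` as `n → ∞`. -/
theorem renyiDiv_tendsto_of_decreasing_sigma_algebras
    {X : Type*} {mX : MeasurableSpace X} (P Q : Measure X)
    [IsProbabilityMeasure P] [IsProbabilityMeasure Q]
    (𝔉 : ℕ → MeasurableSpace X) (hanti : Antitone 𝔉) (hle : ∀ n, 𝔉 n ≤ mX)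
    (α : ℝ≥0∞) (hαfin : α ≠ ⊤)
    (hfin : α < 1 ∨ ∃ m, @renyiDiv X (𝔉 m) α
      (@Measure.trim X (𝔉 m) mX P (hle m)) (@Measure.trim X (𝔉 m) mX Q (hle m)) < ⊤) :
    Tendsto
      (fun n => @renyiDiv X (𝔉 n) α
        (@Measure.trim X (𝔉 n) mX P (hle n)) (@Measure.trim X (𝔉 n) mX Q (hle n)))
      atTop
      (nhds (@renyiDiv X (⨅ n, 𝔉 n) α
        (@Measure.trim X (⨅ n, 𝔉 n) mX P ((iInf_le 𝔉 0).trans (hle 0)))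
        (@Measure.trim X (⨅ n, 𝔉 n) mX Q ((iInf_le 𝔉 0).trans (hle 0))))) := by
  have T := eR_tendsto P Q 𝔉 hanti hle
  have hi : (⨅ n, 𝔉 n) ≤ mX := (iInf_le 𝔉 0).trans (hle 0)
  rcases eq_or_ne α 0 with rfl | h0
  · simp only [div_zero_eq P Q]
    exact tendsto_log_mul (by norm_num) (conv_zero P Q 𝔉 hle (fun n => iInf_le 𝔉 n) T)
  rcases eq_or_ne α 1 with rfl | h1
  · simp only [div_one_eq P Q] at hfin ⊢
    obtain ⟨m, hm⟩ := hfin.resolve_left (lt_irrefl _)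
    have hm' : ∫⁻ x, kG (eR P Q (𝔉 m) x) ∂(P + Q) < ⊤ := by
      rw [lt_top_iff_ne_top]
      intro h
      rw [h] at hm
      simp at hm
    have key := conv_kl P Q (hle m) (fun n => 𝔉 (n + m)) (fun n => hanti (Nat.le_add_left m n))
      (iInf_le 𝔉 m) (T.comp (tendsto_add_atTop_nat m)) hm'
    exact (continuous_coe_ennreal_ereal.tendsto _).comp ((tendsto_add_atTop_iff_nat m).1 key)
  simp only [div_simple_eq P Q _ h0 h1 hαfin] at hfin ⊢
  have hr : α.toReal - 1 ≠ 0 := by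
    intro h
    apply h1
    rw [← ENNReal.ofReal_toReal hαfin, show α.toReal = 1 by linarith, ENNReal.ofReal_one]
  refine tendsto_log_mul (inv_ne_zero hr) ?_
  rcases lt_or_ge α 1 with hlt | hge
  · have : α.toReal ≤ 1 := by
      have := ENNReal.toReal_mono ENNReal.one_ne_top hlt.le
      simpa using this
    exact conv_lt P Q ENNReal.toReal_nonneg this hi 𝔉 hle T
  · have hgt : 1 < α.toReal := by
      have := ENNReal.toReal_mono hαfin hge
      rw [ENNReal.toReal_one] at this
      exact lt_of_le_of_ne this (fun h => hr (by linarith))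
    obtain ⟨m, hm⟩ := hfin.resolve_left (not_lt.2 hge)
    have hm' : ∫⁻ x, phiR α.toReal (eR P Q (𝔉 m) x) ∂(P + Q) < ⊤ := by
      rw [lt_top_iff_ne_top]
      intro h
      rw [h, ENNReal.log_top, EReal.coe_mul_top_of_pos (inv_pos.2 (by linarith))] at hm
      exact lt_irrefl _ hm
    have key := conv_gt P Q hgt (hle m) (fun n => 𝔉 (n + m))
      (fun n => hanti (Nat.le_add_left m n))
      (iInf_le 𝔉 m) (T.comp (tendsto_add_atTop_nat m)) hm'
    exact (tendsto_add_atTop_iff_nat m).1 key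
end

section
/- (Additivity.) For n = 1, 2, …, let (P_n, Q_n) be pairs of probability distributions on measurable spaces (X_n, 𝓐_n). Then for any α ∈ [0,∞] and any finite N, ∑_{n=1}^N D_α(P_n ‖ Q_n) = D_α(P₁ × ⋯ × P_N ‖ Q₁ × ⋯ × Q_N), and, for every α ∈ (0,∞], also ∑_{n=1}^∞ D_α(P_n ‖ Q_n) = D_α(P₁ × P₂ × ⋯ ‖ Q₁ × Q₂ × ⋯), where P₁ × P₂ × ⋯ denotes the infinite product distribution on the product measurable space. -/
open MeasureTheory Real Filter Set
open scoped ENNReal NNReal Topology Classical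

/-- The canonical conversion `EReal → ℝ≥0∞` (sending negative values to `0` and
`⊤` to `⊤`); it is injective on `[0,∞]`, where Rényi divergences take their values. -/
noncomputable def erealToENNReal (x : EReal) : ℝ≥0∞ :=
  if x = ⊤ then ⊤ else ENNReal.ofReal x.toReal


namespace RenyiAdd

theorem ae_absCont {X : Type*} [MeasurableSpace X] (P Q : Measure X) : P ≪ P + Q ∧ Q ≪ P + Q :=
  ⟨Measure.absolutelyContinuous_of_le (Measure.le_add_right le_rfl),
   Measure.absolutelyContinuous_of_le (Measure.le_add_left le_rfl)⟩

/-- Independence of the dominating measure. -/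
theorem hell_eq {X : Type*} [MeasurableSpace X] {α : ℝ} (hα : 0 < α) (P Q ν : Measure X)
    [IsFiniteMeasure P] [IsFiniteMeasure Q] [SigmaFinite ν] {p q : X → ℝ≥0∞}
    (hp : Measurable p) (hq : Measurable q)
    (hP : P = ν.withDensity p) (hQ : Q = ν.withDensity q) :
    hellingerInt α P Q = ∫⁻ x, p x ^ α * q x ^ (1 - α) ∂ν := by
  have hPQ : P + Q = ν.withDensity (p + q) := by
    rw [withDensity_add_left hp, hP, hQ]
  have hPν : P ≪ ν := hP ▸ withDensity_absolutelyContinuous _ _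
  have hQν : Q ≪ ν := hQ ▸ withDensity_absolutelyContinuous _ _
  have h1 := Measure.rnDeriv_mul_rnDeriv (κ := ν) (ae_absCont P Q).1
  have h2 := Measure.rnDeriv_mul_rnDeriv (κ := ν) (ae_absCont P Q).2
  have h3 : P.rnDeriv ν =ᵐ[ν] p := by rw [hP]; exact Measure.rnDeriv_withDensity _ hp
  have h4 : Q.rnDeriv ν =ᵐ[ν] q := by rw [hQ]; exact Measure.rnDeriv_withDensity _ hq
  have h5 : (P + Q).rnDeriv ν =ᵐ[ν] p + q := by
    rw [hPQ]; exact Measure.rnDeriv_withDensity _ (hp.add hq)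
  have h6 : ∀ᵐ x ∂ν, (p + q) x ≠ 0 → P.rnDeriv (P + Q) x < ∞ := by
    rw [← ae_withDensity_iff (hp.add hq), ← hPQ]; exact Measure.rnDeriv_lt_top _ _
  have h7 : ∀ᵐ x ∂ν, (p + q) x ≠ 0 → Q.rnDeriv (P + Q) x < ∞ := by
    rw [← ae_withDensity_iff (hp.add hq), ← hPQ]; exact Measure.rnDeriv_lt_top _ _
  have h8 : ∀ᵐ x ∂ν, (P + Q).rnDeriv ν x < ∞ := Measure.rnDeriv_lt_top _ _
  unfold hellingerInt
  have key : ∀ f : X → ℝ≥0∞, Measurable f →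
      ∫⁻ x, f x ∂(P + Q) = ∫⁻ x, ((p + q) * f) x ∂ν := by
    intro f hf
    rw [hPQ, lintegral_withDensity_eq_lintegral_mul ν (hp.add hq) hf]
  rw [key _ (by fun_prop)]
  apply lintegral_congr_ae
  filter_upwards [h1, h2, h3, h4, h5, h6, h7, h8] with x h1 h2 h3 h4 h5 h6 h7 h8
  rw [← h3, ← h4, ← h1, ← h2]
  simp only [Pi.mul_apply]
  rw [← h5] at h6 h7
  rw [← h5]
  set s := (P + Q).rnDeriv ν x
  by_cases hs : s = 0
  · simp [hs, ENNReal.zero_rpow_of_pos hα]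
  · rw [ENNReal.mul_rpow_of_ne_top (h6 hs).ne h8.ne, ENNReal.mul_rpow_of_ne_top (h7 hs).ne h8.ne]
    have : s = s ^ α * s ^ (1 - α) := by
      rw [← ENNReal.rpow_add _ _ hs h8.ne]; simp
    nth_rewrite 1 [this]
    ring

theorem hell_map {X Y : Type*} [MeasurableSpace X] [MeasurableSpace Y] {α : ℝ}
    (P Q : Measure X) [IsFiniteMeasure P] [IsFiniteMeasure Q] (e : X ≃ᵐ Y) :
    hellingerInt α (P.map e) (Q.map e) = hellingerInt α P Q := by
  unfold hellingerInt
  rw [← Measure.map_add _ _ e.measurable, lintegral_map_equiv]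
  apply lintegral_congr_ae
  filter_upwards [e.measurableEmbedding.rnDeriv_map P (P + Q),
    e.measurableEmbedding.rnDeriv_map Q (P + Q)] with x h1 h2
  rw [h1, h2]

theorem hell_prod {X Y : Type*} [MeasurableSpace X] [MeasurableSpace Y] {α : ℝ} (hα : 0 < α)
    (P Q : Measure X) [IsFiniteMeasure P] [IsFiniteMeasure Q]
    (P' Q' : Measure Y) [IsFiniteMeasure P'] [IsFiniteMeasure Q'] :
    hellingerInt α (P.prod P') (Q.prod Q') = hellingerInt α P Q * hellingerInt α P' Q' := by
  have e1 := Measure.withDensity_rnDeriv_eq _ _ (ae_absCont P Q).1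
  have e2 := Measure.withDensity_rnDeriv_eq _ _ (ae_absCont P Q).2
  have e3 := Measure.withDensity_rnDeriv_eq _ _ (ae_absCont P' Q').1
  have e4 := Measure.withDensity_rnDeriv_eq _ _ (ae_absCont P' Q').2
  have m1 : Measurable fun z : X × Y => P.rnDeriv (P + Q) z.1 * P'.rnDeriv (P' + Q') z.2 := by
    fun_prop
  have m2 : Measurable fun z : X × Y => Q.rnDeriv (P + Q) z.1 * Q'.rnDeriv (P' + Q') z.2 := by
    fun_prop
  have f1 : P.prod P' = ((P + Q).prod (P' + Q')).withDensity
      (fun z => P.rnDeriv (P + Q) z.1 * P'.rnDeriv (P' + Q') z.2) := by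
    rw [← prod_withDensity (Measure.measurable_rnDeriv _ _) (Measure.measurable_rnDeriv _ _),
      e1, e3]
  have f2 : Q.prod Q' = ((P + Q).prod (P' + Q')).withDensity
      (fun z => Q.rnDeriv (P + Q) z.1 * Q'.rnDeriv (P' + Q') z.2) := by
    rw [← prod_withDensity (Measure.measurable_rnDeriv _ _) (Measure.measurable_rnDeriv _ _),
      e2, e4]
  rw [hell_eq hα _ _ ((P + Q).prod (P' + Q')) m1 m2 f1 f2]
  unfold hellingerInt
  rw [← lintegral_prod_mul (by fun_prop) (by fun_prop)]
  apply lintegral_congr_ae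
  have t1 : ∀ᵐ z ∂((P + Q).prod (P' + Q')), Q.rnDeriv (P + Q) z.1 < ∞ :=
    Measure.quasiMeasurePreserving_fst.ae (Measure.rnDeriv_lt_top _ _)
  have t2 : ∀ᵐ z ∂((P + Q).prod (P' + Q')), Q'.rnDeriv (P' + Q') z.2 < ∞ :=
    Measure.quasiMeasurePreserving_snd.ae (Measure.rnDeriv_lt_top _ _)
  filter_upwards [t1, t2] with z h1 h2
  rw [ENNReal.mul_rpow_of_nonneg _ _ hα.le, ENNReal.mul_rpow_of_ne_top h1.ne h2.ne]
  ring

/-- Hölder bound on the Hellinger integrals. -/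
theorem hell_le_rpow {X : Type*} [MeasurableSpace X] {y t : ℝ} (hy : 0 < y) (ht : 0 < t)
    (ht1 : t ≤ 1) (P Q : Measure X) [IsProbabilityMeasure P] [IsProbabilityMeasure Q] :
    hellingerInt (1 + t * (y - 1)) P Q ≤ hellingerInt y P Q ^ t := by
  have hi : ∫⁻ x, P.rnDeriv (P + Q) x ∂(P + Q) = 1 := by
    rw [Measure.lintegral_rnDeriv (ae_absCont P Q).1]; simp
  have := ENNReal.lintegral_mul_norm_pow_le (μ := P + Q)
    (f := fun x => P.rnDeriv (P + Q) x ^ y * Q.rnDeriv (P + Q) x ^ (1 - y))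
    (g := fun x => P.rnDeriv (P + Q) x) (by fun_prop) (by fun_prop) ht.le (sub_nonneg.2 ht1)
    (by ring)
  rw [hi, ENNReal.one_rpow, mul_one] at this
  refine le_trans (le_of_eq ?_) this
  unfold hellingerInt
  congr 1; ext x
  rw [ENNReal.mul_rpow_of_nonneg _ _ ht.le, ← ENNReal.rpow_mul, ← ENNReal.rpow_mul,
    mul_right_comm, ← ENNReal.rpow_add_of_nonneg _ _ (by positivity) (sub_nonneg.2 ht1)]
  congr 2 <;> ring

theorem hell_le_one {X : Type*} [MeasurableSpace X] {a : ℝ} (ha : 0 < a) (ha1 : a < 1)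
    (P Q : Measure X) [IsProbabilityMeasure P] [IsProbabilityMeasure Q] :
    hellingerInt a P Q ≤ 1 := by
  have hi : ∫⁻ x, P.rnDeriv (P + Q) x ∂(P + Q) = 1 := by
    rw [Measure.lintegral_rnDeriv (ae_absCont P Q).1]; simp
  have hi' : ∫⁻ x, Q.rnDeriv (P + Q) x ∂(P + Q) = 1 := by
    rw [Measure.lintegral_rnDeriv (ae_absCont P Q).2]; simp
  have := ENNReal.lintegral_mul_norm_pow_le (μ := P + Q)
    (f := fun x => P.rnDeriv (P + Q) x)
    (g := fun x => Q.rnDeriv (P + Q) x) (by fun_prop) (by fun_prop) ha.le (sub_nonneg.2 ha1.le)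
    (by ring)
  rw [hi, hi', ENNReal.one_rpow, ENNReal.one_rpow, mul_one] at this
  exact this

theorem hell_ac {X : Type*} [MeasurableSpace X] {a : ℝ} (ha1 : 1 < a)
    (P Q : Measure X) [IsProbabilityMeasure P] [IsProbabilityMeasure Q]
    (h : hellingerInt a P Q ≠ ∞) : P ≪ Q := by
  have h1 := ae_lt_top (μ := P + Q) (by fun_prop) h
  refine Measure.AbsolutelyContinuous.mk fun s hs hQ => ?_
  have e1 := Measure.withDensity_rnDeriv_eq _ _ (ae_absCont P Q).1
  have e2 := Measure.withDensity_rnDeriv_eq _ _ (ae_absCont P Q).2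
  rw [← e2, withDensity_apply _ hs, lintegral_eq_zero_iff (by fun_prop)] at hQ
  rw [← e1, withDensity_apply _ hs, lintegral_eq_zero_iff (by fun_prop)]
  filter_upwards [hQ, ae_restrict_of_ae h1] with x hx h1
  rw [Pi.zero_apply] at hx ⊢
  by_contra h0
  rw [hx, ENNReal.zero_rpow_of_neg (by linarith), ENNReal.mul_top] at h1
  · exact lt_irrefl _ h1
  · simp only [ne_eq, ENNReal.rpow_eq_zero_iff]
    rintro (h | h)
    · exact h0 h.1
    · linarith [h.2]

theorem hell_of_ac {X : Type*} [MeasurableSpace X] {a : ℝ} (ha : 0 < a)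
    (P Q : Measure X) [IsProbabilityMeasure P] [IsProbabilityMeasure Q]
    (h : P ≪ Q) : hellingerInt a P Q = ∫⁻ x, P.rnDeriv Q x ^ a ∂Q := by
  rw [hell_eq ha P Q Q (Measure.measurable_rnDeriv P Q) (q := 1) measurable_one
    (Measure.withDensity_rnDeriv_eq _ _ h).symm (by simp)]
  simp

/-- Data processing for orders above one. -/
theorem hell_dpi {X Y : Type*} [MeasurableSpace X] [MeasurableSpace Y] {a : ℝ} (ha1 : 1 < a)
    (P Q : Measure X) [IsProbabilityMeasure P] [IsProbabilityMeasure Q] {T : X → Y}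
    (hT : Measurable T) : hellingerInt a (P.map T) (Q.map T) ≤ hellingerInt a P Q := by
  have ha : 0 < a := by linarith
  by_cases h : hellingerInt a P Q = ∞
  · rw [h]; exact le_top
  have hac := hell_ac ha1 P Q h
  have hacT : P.map T ≪ Q.map T := hac.map hT
  have := Measure.isProbabilityMeasure_map (μ := P) hT.aemeasurable
  have := Measure.isProbabilityMeasure_map (μ := Q) hT.aemeasurable
  set H := hellingerInt a P Q with hH
  rw [hell_of_ac ha _ _ hac] at hH
  rw [hell_of_ac ha _ _ hacT]
  set r := (P.map T).rnDeriv (Q.map T) with hr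
  have hrm : Measurable r := Measure.measurable_rnDeriv _ _
  have bound : ∀ k : ℕ, ∫⁻ y, (min (r y) k) ^ a ∂(Q.map T) ≤ H := by
    intro k
    set A := ∫⁻ y, (min (r y) k) ^ a ∂(Q.map T) with hA
    have hAfin : A ≠ ∞ := by
      refine ne_top_of_le_ne_top (b := (k : ℝ≥0∞) ^ a) (by simp [ha.le]) ?_
      calc A ≤ ∫⁻ y, (k : ℝ≥0∞) ^ a ∂(Q.map T) :=
            lintegral_mono fun y => ENNReal.rpow_le_rpow (min_le_right _ _) ha.le
        _ = _ := by simp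
    have c1 : A ≤ ∫⁻ x, P.rnDeriv Q x * (min (r (T x)) k) ^ (a - 1) ∂Q := by
      calc A ≤ ∫⁻ y, r y * (min (r y) k) ^ (a - 1) ∂(Q.map T) := by
            refine lintegral_mono fun y => ?_
            calc (min (r y) k) ^ a = (min (r y) k) ^ (1 + (a - 1)) := by ring_nf
              _ = min (r y) k * (min (r y) k) ^ (a - 1) := by
                rw [ENNReal.rpow_add_of_nonneg _ _ zero_le_one (by linarith), ENNReal.rpow_one]
              _ ≤ _ := by gcongr; exact min_le_left _ _
        _ = ∫⁻ y, (min (r y) k) ^ (a - 1) ∂(P.map T) :=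
            lintegral_rnDeriv_mul hacT (by fun_prop)
        _ = ∫⁻ x, (min (r (T x)) k) ^ (a - 1) ∂P := lintegral_map (by fun_prop) hT
        _ = _ := (lintegral_rnDeriv_mul hac (by fun_prop)).symm
    have c2 : ∫⁻ x, P.rnDeriv Q x * (min (r (T x)) k) ^ (a - 1) ∂Q
        ≤ H ^ (1 / a) * A ^ (1 - 1 / a) := by
      have hi : 1 / a ≤ 1 := by rw [div_le_one ha]; exact ha1.le
      have := ENNReal.lintegral_mul_norm_pow_le (μ := Q)
        (f := fun x => P.rnDeriv Q x ^ a)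
        (g := fun x => (min (r (T x)) k) ^ a) (by fun_prop) (by fun_prop)
        (p := 1 / a) (q := 1 - 1 / a) (by positivity) (sub_nonneg.2 hi) (by ring)
      rw [← hH, ← lintegral_map (f := fun y => (min (r y) k) ^ a) (by fun_prop) hT] at this
      refine le_trans (le_of_eq ?_) this
      congr 1; ext x
      rw [← ENNReal.rpow_mul, ← ENNReal.rpow_mul, mul_one_div_cancel ha.ne', ENNReal.rpow_one]
      congr 2; field_simp
    have c3 := c1.trans c2
    by_cases hA0 : A = 0
    · rw [hA0]; exact zero_le
    have hsplit : A = A ^ (1 / a) * A ^ (1 - 1 / a) := by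
      rw [← ENNReal.rpow_add _ _ hA0 hAfin]; simp
    nth_rewrite 1 [hsplit] at c3
    have hne : A ^ (1 - 1 / a) ≠ 0 := by
      rw [ne_eq, ENNReal.rpow_eq_zero_iff]; tauto
    have hne' : A ^ (1 - 1 / a) ≠ ∞ := ENNReal.rpow_ne_top_of_ne_zero hA0 hAfin 
    have c4 := (ENNReal.mul_le_mul_iff_left hne hne').1 c3
    exact (ENNReal.rpow_le_rpow_iff (by positivity)).1 c4
  have hsup : ∀ y, r y ^ a = ⨆ k : ℕ, (min (r y) k) ^ a := by
    intro y
    apply le_antisymm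
    · have ht : Tendsto (fun k : ℕ => (min (r y) k) ^ a) atTop (𝓝 ((min (r y) ∞) ^ a)) :=
        (ENNReal.continuous_rpow_const.tendsto _).comp
          (tendsto_const_nhds.min ENNReal.tendsto_nat_nhds_top)
      rw [min_eq_left le_top] at ht
      exact le_of_tendsto' ht fun k => le_iSup (fun k : ℕ => (min (r y) k) ^ a) k
    · exact iSup_le fun k => ENNReal.rpow_le_rpow (min_le_left _ _) ha.le
  simp_rw [hsup]
  rw [lintegral_iSup (fun k => by fun_prop)]
  · exact iSup_le bound
  · intro i j hij y
    apply ENNReal.rpow_le_rpow _ ha.le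
    exact min_le_min_left _ (by exact_mod_cast hij)

theorem hell_self {X : Type*} [MeasurableSpace X] {a : ℝ} (ha : 0 < a)
    (P : Measure X) [IsProbabilityMeasure P] : hellingerInt a P P = 1 := by
  rw [hell_eq ha P P P (p := 1) (q := 1) measurable_one measurable_one (by simp) (by simp)]
  simp

theorem one_le_hell {X : Type*} [MeasurableSpace X] {a : ℝ} (ha1 : 1 < a)
    (P Q : Measure X) [IsProbabilityMeasure P] [IsProbabilityMeasure Q] :
    1 ≤ hellingerInt a P Q := by
  have := hell_dpi ha1 P Q (T := fun _ => ()) measurable_const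
  simp only [Measure.map_const, measure_univ, one_smul] at this
  rwa [hell_self (by linarith)] at this

theorem hell_pi {α : ℝ} (hα : 0 < α) : ∀ (N : ℕ) (X : Fin N → Type*)
    [∀ n, MeasurableSpace (X n)]
    (P Q : ∀ n, Measure (X n))
    [∀ n, IsProbabilityMeasure (P n)] [∀ n, IsProbabilityMeasure (Q n)],
    hellingerInt α (Measure.pi P) (Measure.pi Q) = ∏ i, hellingerInt α (P i) (Q i) := by
  intro N
  induction N with
  | zero =>
    intro X _ P Q _ _
    rw [Measure.pi_of_empty P, Measure.pi_of_empty Q, hell_self hα]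
    simp
  | succ N ih =>
    intro X _ P Q _ _
    rw [Fin.prod_univ_succAbove _ 0, ← ih, ← hell_prod hα,
      ← (measurePreserving_piFinSuccAbove P 0).map_eq,
      ← (measurePreserving_piFinSuccAbove Q 0).map_eq, hell_map]

end RenyiAdd

namespace RenyiAdd

/-- Restriction to the first `N` coordinates. -/
def proj (X : ℕ → Type*) (N : ℕ) : (∀ n, X n) → ∀ i : Fin N, X i := fun x i => x i

theorem measurable_proj (X : ℕ → Type*) [∀ n, MeasurableSpace (X n)] (N : ℕ) :
    Measurable (proj X N) :=
  measurable_pi_lambda _ fun i => measurable_pi_apply (i : ℕ)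

/-- The filtration generated by the first coordinates. -/
def filt (X : ℕ → Type*) [∀ n, MeasurableSpace (X n)] :
    Filtration ℕ (MeasurableSpace.pi : MeasurableSpace (∀ n, X n)) where
  seq N := MeasurableSpace.comap (proj X N) MeasurableSpace.pi
  mono' := by
    intro N M h
    have : proj X N = (fun (y : ∀ i : Fin M, X i) (i : Fin N) => y (Fin.castLE h i)) ∘ proj X M := by
      ext x i; rfl
    show MeasurableSpace.comap (proj X N) _ ≤ _
    rw [this, ← MeasurableSpace.comap_comp]
    refine MeasurableSpace.comap_mono ?_
    rw [← measurable_iff_comap_le]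
    exact measurable_pi_lambda _ fun i => measurable_pi_apply (Fin.castLE h i)
  le' N := (measurable_proj X N).comap_le

theorem filt_iSup (X : ℕ → Type*) [∀ n, MeasurableSpace (X n)] :
    (⨆ n, filt X n) = (MeasurableSpace.pi : MeasurableSpace (∀ n, X n)) := by
  apply le_antisymm
  · exact iSup_le fun n => (filt X).le n
  · unfold MeasurableSpace.pi
    refine iSup_le fun a => le_trans ?_ (le_iSup _ (a + 1))
    have : (fun b : ∀ n, X n => b a) =
        (fun y : ∀ i : Fin (a + 1), X i => y (Fin.last a)) ∘ proj X (a + 1) := by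
      ext x; rfl
    show _ ≤ MeasurableSpace.comap (proj X (a + 1)) MeasurableSpace.pi
    rw [this, ← MeasurableSpace.comap_comp]
    refine MeasurableSpace.comap_mono ?_
    rw [← measurable_iff_comap_le]
    exact measurable_pi_apply (Fin.last a)

theorem dens_tendsto {X : ℕ → Type*} [∀ n, MeasurableSpace (X n)]
    (P ν : Measure (∀ n, X n)) [IsFiniteMeasure P] [IsFiniteMeasure ν] (h : P ≪ ν) :
    ∀ᵐ x ∂ν, Tendsto (fun N => (P.map (proj X N)).rnDeriv (ν.map (proj X N)) (proj X N x))
      atTop (𝓝 (P.rnDeriv ν x)) := by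
  have h1 : ∀ᵐ x ∂ν, ∀ N, ((P.map (proj X N)).rnDeriv (ν.map (proj X N)) (proj X N x)).toReal =
      (ν[(fun a ↦ (P.rnDeriv ν a).toReal) | filt X N]) x :=
    ae_all_iff.2 fun N => toReal_rnDeriv_map h (measurable_proj X N)
  have h2 : ∀ᵐ x ∂ν, ∀ N, (P.map (proj X N)).rnDeriv (ν.map (proj X N)) (proj X N x) < ∞ :=
    ae_all_iff.2 fun N => ae_of_ae_map (measurable_proj X N).aemeasurable
      (Measure.rnDeriv_lt_top _ _)
  have h3 : ∀ᵐ x ∂ν, P.rnDeriv ν x < ∞ := Measure.rnDeriv_lt_top _ _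
  have h4 := (Measure.integrable_toReal_rnDeriv (μ := P) (ν := ν)).tendsto_ae_condExp
    (ℱ := filt X) (by
      rw [filt_iSup]
      exact (Measure.measurable_rnDeriv P ν).ennreal_toReal.stronglyMeasurable)
  filter_upwards [h1, h2, h3, h4] with x h1 h2 h3 h4
  simp_rw [← h1] at h4
  have := ENNReal.tendsto_ofReal h4
  simpa [ENNReal.ofReal_toReal h3.ne, ENNReal.ofReal_toReal (h2 _).ne] using this

theorem hell_tendsto {X : ℕ → Type*} [∀ n, MeasurableSpace (X n)] {a : ℝ} (ha : 0 < a)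
    (ha1 : a ≠ 1)
    (P Q : Measure (∀ n, X n)) [IsProbabilityMeasure P] [IsProbabilityMeasure Q] :
    Tendsto (fun N => hellingerInt a (P.map (proj X N)) (Q.map (proj X N))) atTop
      (𝓝 (hellingerInt a P Q)) := by
  have hP := dens_tendsto P (P + Q) (ae_absCont P Q).1
  have hQ := dens_tendsto Q (P + Q) (ae_absCont P Q).2
  set p := fun N x => (P.map (proj X N)).rnDeriv ((P + Q).map (proj X N)) (proj X N x) with hp
  set q := fun N x => (Q.map (proj X N)).rnDeriv ((P + Q).map (proj X N)) (proj X N x) with hq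
  have hmp : ∀ N, Measurable (p N) := fun N =>
    (Measure.measurable_rnDeriv _ _).comp (measurable_proj X N)
  have hmq : ∀ N, Measurable (q N) := fun N =>
    (Measure.measurable_rnDeriv _ _).comp (measurable_proj X N)
  have hH : ∀ N, hellingerInt a (P.map (proj X N)) (Q.map (proj X N))
      = ∫⁻ x, p N x ^ a * q N x ^ (1 - a) ∂(P + Q) := by
    intro N
    unfold hellingerInt
    rw [← Measure.map_add _ _ (measurable_proj X N),
      lintegral_map (by fun_prop) (measurable_proj X N)]
  have hle : ∀ N, ∀ᵐ x ∂(P + Q), p N x ≤ 1 ∧ q N x ≤ 1 := by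
    intro N
    have hm := measurable_proj X N
    filter_upwards [ae_of_ae_map hm.aemeasurable (Measure.rnDeriv_le_one_of_le
        (μ := P.map (proj X N)) (ν := (P + Q).map (proj X N))
        (by rw [Measure.map_add _ _ hm]; exact Measure.le_add_right le_rfl)),
      ae_of_ae_map hm.aemeasurable (Measure.rnDeriv_le_one_of_le
        (μ := Q.map (proj X N)) (ν := (P + Q).map (proj X N))
        (by rw [Measure.map_add _ _ hm]; exact Measure.le_add_left le_rfl))] with x h1 h2
    exact ⟨h1, h2⟩
  have hlt1 : ∀ᵐ x ∂(P + Q), P.rnDeriv (P + Q) x < ∞ := Measure.rnDeriv_lt_top _ _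
  have hlt2 : ∀ᵐ x ∂(P + Q), Q.rnDeriv (P + Q) x < ∞ := Measure.rnDeriv_lt_top _ _
  have hsum : ∀ᵐ x ∂(P + Q), P.rnDeriv (P + Q) x + Q.rnDeriv (P + Q) x = 1 := by
    filter_upwards [Measure.rnDeriv_add' P Q (P + Q), Measure.rnDeriv_self (P + Q)] with x h1 h2
    rw [← h2, h1]; rfl
  have hlim : ∀ᵐ x ∂(P + Q), Tendsto (fun N => p N x ^ a * q N x ^ (1 - a)) atTop
      (𝓝 (P.rnDeriv (P + Q) x ^ a * Q.rnDeriv (P + Q) x ^ (1 - a))) := by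
    filter_upwards [hP, hQ, hlt1, hlt2, hsum] with x h1 h2 h3 h4 h5
    refine ENNReal.Tendsto.mul ((ENNReal.continuous_rpow_const.tendsto _).comp h1) ?_
      ((ENNReal.continuous_rpow_const.tendsto _).comp h2) ?_
    · by_cases h0 : P.rnDeriv (P + Q) x = 0
      · right
        rw [h0, zero_add] at h5
        simp [h5]
      · left
        simp only [ne_eq, ENNReal.rpow_eq_zero_iff]
        rintro (h | h)
        · exact h0 h.1
        · exact h3.ne h.1
    · right
      exact ENNReal.rpow_ne_top_of_nonneg ha.le h3.ne
  simp_rw [hH]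
  rcases lt_or_gt_of_ne ha1 with h1 | h1
  · refine tendsto_lintegral_of_dominated_convergence (fun _ => 1)
      (fun N => by have := hmp N; have := hmq N; fun_prop) (fun N => ?_) (by simp) hlim
    filter_upwards [hle N] with x hx
    exact mul_le_one' (ENNReal.rpow_le_one hx.1 ha.le) (ENNReal.rpow_le_one hx.2 (by linarith))
  · refine tendsto_of_le_liminf_of_limsup_le ?_ ?_
    · calc hellingerInt a P Q
          = ∫⁻ x, liminf (fun N => p N x ^ a * q N x ^ (1 - a)) atTop ∂(P + Q) := by
            apply lintegral_congr_ae
            filter_upwards [hlim] with x hx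
            exact hx.liminf_eq.symm
        _ ≤ _ := lintegral_liminf_le (fun N => by have := hmp N; have := hmq N; fun_prop)
    · refine limsup_le_of_le (by isBoundedDefault) (Eventually.of_forall fun N => ?_)
      rw [← hH]
      exact hell_dpi h1 P Q (measurable_proj X N)

/-! ### Simple orders -/

theorem simple_eq {X : Type*} [MeasurableSpace X] (a : ℝ) (P Q : Measure X) :
    renyiSimple a P Q = ENNReal.log (hellingerInt a P Q ^ (a - 1)⁻¹) := by
  rw [ENNReal.log_rpow]; rfl

theorem rpow_anti {x y : ℝ≥0∞} {c : ℝ} (hc : c ≤ 0) (h : x ≤ y) : y ^ c ≤ x ^ c := by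
  obtain ⟨d, rfl⟩ : ∃ d, c = -d := ⟨-c, by ring⟩
  rw [ENNReal.rpow_neg, ENNReal.rpow_neg, ENNReal.inv_le_inv]
  exact ENNReal.rpow_le_rpow h (by linarith)

theorem simple_nonneg {X : Type*} [MeasurableSpace X] {a : ℝ} (ha : 0 < a) (ha1 : a ≠ 1)
    (P Q : Measure X) [IsProbabilityMeasure P] [IsProbabilityMeasure Q] :
    0 ≤ renyiSimple a P Q := by
  rw [simple_eq, ENNReal.zero_le_log_iff]
  rcases lt_or_gt_of_ne ha1 with h1 | h1
  · have := rpow_anti (c := (a - 1)⁻¹) (inv_nonpos.2 (by linarith)) (hell_le_one ha h1 P Q)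
    simpa using this
  · have := ENNReal.rpow_le_rpow (z := (a - 1)⁻¹) (one_le_hell h1 P Q)
      (inv_nonneg.2 (by linarith))
    simpa using this

theorem simple_mono_lt {X : Type*} [MeasurableSpace X]
    (P Q : Measure X) [IsProbabilityMeasure P] [IsProbabilityMeasure Q] :
    MonotoneOn (fun a => renyiSimple a P Q) (Ioo 0 1) := by
  intro a ha b hb hab
  simp only [simple_eq]
  apply ENNReal.log_le_log
  have h1 : 0 < 1 - a := by linarith [ha.2]
  have h2 : 0 < 1 - b := by linarith [hb.2]
  have := hell_le_rpow (y := a) (t := (1 - b) / (1 - a)) ha.1 (by positivity)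
    (by rw [div_le_one h1]; linarith) P Q
  rw [show 1 + (1 - b) / (1 - a) * (a - 1) = b by field_simp; ring] at this
  refine le_trans (le_of_eq ?_) (rpow_anti (c := (b - 1)⁻¹) (inv_nonpos.2 (by linarith)) this)
  rw [← ENNReal.rpow_mul]
  congr 1
  have h3 : a - 1 ≠ 0 := by linarith
  have h4 : b - 1 ≠ 0 := by linarith
  field_simp
  ring

theorem simple_mono_gt {X : Type*} [MeasurableSpace X]
    (P Q : Measure X) [IsProbabilityMeasure P] [IsProbabilityMeasure Q] :
    MonotoneOn (fun a => renyiSimple a P Q) (Ioi 1) := by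
  intro a ha b hb hab
  rw [mem_Ioi] at ha hb
  simp only [simple_eq]
  apply ENNReal.log_le_log
  have h1 : 0 < a - 1 := by linarith
  have h2 : 0 < b - 1 := by linarith
  have := hell_le_rpow (y := b) (t := (a - 1) / (b - 1)) (by linarith) (by positivity)
    (by rw [div_le_one h2]; linarith) P Q
  rw [show 1 + (a - 1) / (b - 1) * (b - 1) = a by field_simp; ring] at this
  refine le_trans (ENNReal.rpow_le_rpow (z := (a - 1)⁻¹) this (by positivity)) (le_of_eq ?_)
  rw [← ENNReal.rpow_mul]
  congr 1
  field_simp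

theorem log_prod {ι : Type*} (s : Finset ι) (f : ι → ℝ≥0∞) :
    ENNReal.log (∏ i ∈ s, f i) = ∑ i ∈ s, ENNReal.log (f i) := by
  induction s using Finset.cons_induction with
  | empty => simp
  | cons a s ha ih => rw [Finset.prod_cons, Finset.sum_cons, ENNReal.log_mul_add, ih]

theorem simple_pi {a : ℝ} (ha : 0 < a) (ha1 : a ≠ 1) (N : ℕ) (X : Fin N → Type*)
    [∀ n, MeasurableSpace (X n)]
    (P Q : ∀ n, Measure (X n))
    [∀ n, IsProbabilityMeasure (P n)] [∀ n, IsProbabilityMeasure (Q n)] :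
    renyiSimple a (Measure.pi P) (Measure.pi Q) = ∑ i, renyiSimple a (P i) (Q i) := by
  simp_rw [simple_eq]
  rw [← log_prod, hell_pi ha]
  congr 1
  rcases lt_or_gt_of_ne ha1 with h1 | h1
  · rw [ENNReal.prod_rpow_of_ne_top]
    exact fun i _ => ne_top_of_le_ne_top ENNReal.one_ne_top (hell_le_one ha h1 _ _)
  · rw [ENNReal.prod_rpow_of_nonneg]
    exact inv_nonneg.2 (by linarith)

/-- Simple Rényi divergence, with values in `[0,∞]`. -/
noncomputable def dd {X : Type*} [MeasurableSpace X] (a : ℝ) (P Q : Measure X) : ℝ≥0∞ :=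
  (renyiSimple a P Q).toENNReal

theorem coe_dd {X : Type*} [MeasurableSpace X] {a : ℝ} (ha : 0 < a) (ha1 : a ≠ 1)
    (P Q : Measure X) [IsProbabilityMeasure P] [IsProbabilityMeasure Q] :
    (dd a P Q : EReal) = renyiSimple a P Q :=
  EReal.coe_toENNReal (simple_nonneg ha ha1 P Q)

theorem coe_fsum {ι : Type*} (s : Finset ι) (f : ι → ℝ≥0∞) :
    ((∑ i ∈ s, f i : ℝ≥0∞) : EReal) = ∑ i ∈ s, (f i : EReal) := by
  induction s using Finset.cons_induction with
  | empty => simp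
  | cons a s ha ih => rw [Finset.sum_cons, Finset.sum_cons, EReal.coe_ennreal_add, ih]

theorem dd_pi {a : ℝ} (ha : 0 < a) (ha1 : a ≠ 1) (N : ℕ) (X : Fin N → Type*)
    [∀ n, MeasurableSpace (X n)]
    (P Q : ∀ n, Measure (X n))
    [∀ n, IsProbabilityMeasure (P n)] [∀ n, IsProbabilityMeasure (Q n)] :
    dd a (Measure.pi P) (Measure.pi Q) = ∑ i, dd a (P i) (Q i) := by
  rw [← EReal.coe_ennreal_eq_coe_ennreal_iff, coe_fsum, coe_dd ha ha1, simple_pi ha ha1]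
  exact Finset.sum_congr rfl fun i _ => (coe_dd ha ha1 _ _).symm

theorem dd_inf {X : ℕ → Type*} [∀ n, MeasurableSpace (X n)] {a : ℝ} (ha : 0 < a)
    (ha1 : a ≠ 1) (P Q : ∀ n, Measure (X n))
    [∀ n, IsProbabilityMeasure (P n)] [∀ n, IsProbabilityMeasure (Q n)]
    (Pinf Qinf : Measure (∀ n, X n)) [IsProbabilityMeasure Pinf] [IsProbabilityMeasure Qinf]
    (hP : ∀ N : ℕ, Measure.map (proj X N) Pinf = Measure.pi fun i : Fin N => P i)
    (hQ : ∀ N : ℕ, Measure.map (proj X N) Qinf = Measure.pi fun i : Fin N => Q i) :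
    dd a Pinf Qinf = ∑' n, dd a (P n) (Q n) := by
  have h1 := ENNReal.tendsto_nat_tsum fun n => dd a (P n) (Q n)
  have h2 : Tendsto (fun N => dd a (Pinf.map (proj X N)) (Qinf.map (proj X N))) atTop
      (𝓝 (dd a Pinf Qinf)) := by
    unfold dd
    simp_rw [simple_eq]
    exact ((EReal.continuous_toENNReal.comp (ENNReal.continuous_log.comp
      ENNReal.continuous_rpow_const)).tendsto _).comp (hell_tendsto ha ha1 Pinf Qinf)
  refine tendsto_nhds_unique h2 (h1.congr fun N => ?_)
  rw [hP, hQ, dd_pi ha ha1, Finset.sum_range]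

universe u

/-- All orders as limits of simple orders. -/
theorem lim_data (α : ℝ≥0∞) : ∃ (l : Filter ℝ) (S : Set ℝ), l.NeBot ∧ S ∈ l ∧
    (∀ a ∈ S, 0 < a ∧ a ≠ 1) ∧
    ∀ {X : Type u} [MeasurableSpace X] (P Q : Measure X) [IsProbabilityMeasure P]
      [IsProbabilityMeasure Q], ∃ L : ℝ≥0∞, renyiDiv α P Q = (L : EReal) ∧
        Tendsto (fun a => dd a P Q) l (𝓝 L) ∧ (α ≠ 0 → ∀ a ∈ S, dd a P Q ≤ L) := by
  have aux : ∀ (l : Filter ℝ) [l.NeBot] (S : Set ℝ), S ∈ l → (∀ a ∈ S, 0 < a ∧ a ≠ 1) →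
      ∀ {X : Type u} [MeasurableSpace X] (P Q : Measure X) [IsProbabilityMeasure P]
      [IsProbabilityMeasure Q] (L : ℝ≥0∞), Tendsto (fun a => dd a P Q) l (𝓝 L) →
      limsup (fun a => renyiSimple a P Q) l = (L : EReal) := by
    intro l _ S hS hS' X _ P Q _ _ L hL
    apply Tendsto.limsup_eq
    refine ((continuous_coe_ennreal_ereal.tendsto L).comp hL).congr' ?_
    filter_upwards [hS] with a ha
    exact coe_dd (hS' a ha).1 (hS' a ha).2 P Q
  have hIoo : ∀ a ∈ Ioo (0 : ℝ) 1, 0 < a ∧ a ≠ 1 := fun a ha => ⟨ha.1, ha.2.ne⟩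
  have hIoi : ∀ a ∈ Ioi (1 : ℝ), 0 < a ∧ a ≠ 1 := fun a ha =>
    ⟨zero_lt_one.trans ha, (ne_of_gt ha)⟩
  by_cases h0 : α = 0
  · have hS : Ioo (0 : ℝ) 1 ∈ 𝓝[>] (0 : ℝ) := Ioo_mem_nhdsGT zero_lt_one
    refine ⟨𝓝[>] 0, Ioo 0 1, inferInstance, hS, hIoo, fun {X} _ P Q _ _ => ?_⟩
    have hm : MonotoneOn (fun a => dd a P Q) (Ioo 0 1) := fun a ha b hb hab =>
      EReal.toENNReal_le_toENNReal (simple_mono_lt P Q ha hb hab)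
    have ht := hm.tendsto_nhdsWithin_Ioo_right (nonempty_Ioo.2 zero_lt_one) (OrderBot.bddBelow _)
    refine ⟨_, ?_, ht, fun h => absurd h0 h⟩
    rw [renyiDiv, if_pos h0]
    exact aux _ _ hS hIoo P Q _ ht
  by_cases h1 : α = 1
  · have hS : Ioo (0 : ℝ) 1 ∈ 𝓝[<] (1 : ℝ) := Ioo_mem_nhdsLT zero_lt_one
    refine ⟨𝓝[<] 1, Ioo 0 1, inferInstance, hS, hIoo, fun {X} _ P Q _ _ => ?_⟩
    have hm : MonotoneOn (fun a => dd a P Q) (Ioo 0 1) := fun a ha b hb hab =>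
      EReal.toENNReal_le_toENNReal (simple_mono_lt P Q ha hb hab)
    have ht := hm.tendsto_nhdsWithin_Ioo_left (nonempty_Ioo.2 zero_lt_one) (OrderTop.bddAbove _)
    refine ⟨_, ?_, ht, fun _ a ha => le_sSup (mem_image_of_mem _ ha)⟩
    rw [renyiDiv, if_neg h0, if_pos h1]
    exact aux _ _ hS hIoo P Q _ ht
  by_cases h2 : α = ∞
  · have hS : Ioi (1 : ℝ) ∈ (atTop : Filter ℝ) := Ioi_mem_atTop 1
    refine ⟨atTop, Ioi 1, inferInstance, hS, hIoi, fun {X} _ P Q _ _ => ?_⟩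
    have hm : MonotoneOn (fun a => dd a P Q) (Ioi 1) := fun a ha b hb hab =>
      EReal.toENNReal_le_toENNReal (simple_mono_gt P Q ha hb hab)
    have hm' : Monotone (fun a => dd (max a 2) P Q) := fun a b hab =>
      hm (lt_of_lt_of_le one_lt_two (le_max_right a 2)) (lt_of_lt_of_le one_lt_two (le_max_right b 2))
        (max_le_max_right _ hab)
    have ht := (tendsto_atTop_iSup hm').congr' (f₂ := fun a => dd a P Q) (by
      filter_upwards [Ici_mem_atTop (2 : ℝ)] with a ha
      rw [max_eq_left ha])
    refine ⟨_, ?_, ht, fun _ a ha => ?_⟩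
    · rw [renyiDiv, if_neg h0, if_neg h1, if_pos h2]
      exact aux _ _ hS hIoi P Q _ ht
    · refine ge_of_tendsto ht ?_
      filter_upwards [Ici_mem_atTop a] with b hb
      exact hm ha (mem_Ioi.2 (lt_of_lt_of_le (mem_Ioi.1 ha) (mem_Ici.1 hb))) (mem_Ici.1 hb)
  · have hα : 0 < α.toReal ∧ α.toReal ≠ 1 :=
      ⟨ENNReal.toReal_pos h0 h2, fun h => h1 (by
        rw [← ENNReal.ofReal_toReal h2, h, ENNReal.ofReal_one])⟩
    refine ⟨pure α.toReal, {α.toReal}, inferInstance, by simp, by simpa using hα,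
      fun {X} _ P Q _ _ => ⟨dd α.toReal P Q, ?_, ?_, ?_⟩⟩
    · rw [renyiDiv, if_neg h0, if_neg h1, if_neg h2, coe_dd hα.1 hα.2]
    · exact tendsto_pure_nhds _ _
    · rintro - a rfl
      exact le_rfl

theorem toENN_eq (x : ℝ≥0∞) : erealToENNReal (x : EReal) = x :=
  EReal.toENNReal_coe

end RenyiAdd

/-- **Additivity.** For pairs `(P n, Q n)` of probability distributions on measurable
spaces `X n`: for every order `α ∈ [0,∞]` and every finite `N`,
`∑_{n<N} D_α(P n ‖ Q n) = D_α(P 0 × ⋯ × P (N-1) ‖ Q 0 × ⋯ × Q (N-1))`; and for every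
`α ∈ (0,∞]`, `∑_{n=0}^∞ D_α(P n ‖ Q n) = D_α(P 0 × P 1 × ⋯ ‖ Q 0 × Q 1 × ⋯)`, where the
infinite products are (the necessarily unique) probability measures on `Π n, X n` whose
finite-dimensional marginals are the corresponding finite products. -/
theorem renyiDiv_additivity
    {X : ℕ → Type*} [∀ n, MeasurableSpace (X n)]
    (P Q : ∀ n, Measure (X n))
    [∀ n, IsProbabilityMeasure (P n)] [∀ n, IsProbabilityMeasure (Q n)]
    (α : ℝ≥0∞) :
    (∀ N : ℕ,
      ∑ i : Fin N, renyiDiv α (P i) (Q i)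
        = renyiDiv α (Measure.pi fun i : Fin N => P i) (Measure.pi fun i : Fin N => Q i)) ∧
    (α ≠ 0 →
      ∀ Pinf Qinf : Measure (∀ n, X n),
        IsProbabilityMeasure Pinf → IsProbabilityMeasure Qinf →
        (∀ N : ℕ, Measure.map (fun x (i : Fin N) => x i) Pinf
          = Measure.pi fun i : Fin N => P i) →
        (∀ N : ℕ, Measure.map (fun x (i : Fin N) => x i) Qinf
          = Measure.pi fun i : Fin N => Q i) →
        ∑' n : ℕ, erealToENNReal (renyiDiv α (P n) (Q n))
          = erealToENNReal (renyiDiv α Pinf Qinf)) := by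
  obtain ⟨l, S, hl, hS, hS', hlim⟩ := RenyiAdd.lim_data α
  choose L hL using fun n => hlim (P n) (Q n)
  refine ⟨fun N => ?_, fun h0 Pinf Qinf _ _ hP hQ => ?_⟩
  · obtain ⟨M, hM1, hM2, -⟩ := hlim (Measure.pi fun i : Fin N => P i)
      (Measure.pi fun i : Fin N => Q i)
    rw [hM1]
    simp_rw [fun i : Fin N => (hL i).1]
    rw [← RenyiAdd.coe_fsum]
    congr 1
    refine tendsto_nhds_unique (tendsto_finsetSum Finset.univ
      fun (i : Fin N) _ => (hL i).2.1) (hM2.congr' ?_)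
    filter_upwards [hS] with a ha
    exact RenyiAdd.dd_pi (hS' a ha).1 (hS' a ha).2 N (fun i : Fin N => X i) _ _
  · obtain ⟨M, hM1, hM2, -⟩ := hlim Pinf Qinf
    rw [hM1, RenyiAdd.toENN_eq]
    simp_rw [fun n => (hL n).1, RenyiAdd.toENN_eq]
    have hsum : ∀ a ∈ S, RenyiAdd.dd a Pinf Qinf = ∑' n, RenyiAdd.dd a (P n) (Q n) := fun a ha =>
      RenyiAdd.dd_inf (hS' a ha).1 (hS' a ha).2 P Q Pinf Qinf hP hQ
    apply le_antisymm
    · rw [ENNReal.tsum_eq_iSup_sum]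
      refine iSup_le fun s => ?_
      refine le_of_tendsto_of_tendsto (tendsto_finsetSum s
        fun i _ => (hL i).2.1) hM2 ?_
      filter_upwards [hS] with a ha
      rw [hsum a ha]
      exact ENNReal.sum_le_tsum s
    · refine le_of_tendsto hM2 ?_
      filter_upwards [hS] with a ha
      rw [hsum a ha]
      exact ENNReal.tsum_le_tsum fun n => (hL n).2.2 h0 a ha
end

section
/- (Kakutani's dichotomy.) Let α ∈ (0,1), and let P = P₁ × P₂ × ⋯ and Q = Q₁ × Q₂ × ⋯ be infinite product distributions, where for each n the distributions P_n and Q_n on an arbitrary measurable space (X_n, 𝓐_n) are equivalent (each absolutely continuous with respect to the other). Then P and Q are equivalent if and only if ∑_{n=1}^∞ D_α(P_n ‖ Q_n) < ∞, and P and Q are mutually singular if and only if ∑_{n=1}^∞ D_α(P_n ‖ Q_n) = ∞. -/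
open MeasureTheory Real Filter Set
open scoped ENNReal NNReal Topology Classical

lemma kk_hell_eq {X : Type*} [MeasurableSpace X] (α : ℝ) (hα0 : 0 < α) (hα1 : α < 1)
    (P Q : Measure X) [IsProbabilityMeasure P] [IsProbabilityMeasure Q] (hPQ : P ≪ Q) :
    hellingerInt α P Q = ∫⁻ x, P.rnDeriv Q x ^ α ∂Q := by
  have hQ : Q ≪ P + Q := Measure.AbsolutelyContinuous.rfl.add_right' P
  rw [hellingerInt, ← lintegral_rnDeriv_mul hQ
    ((Measure.measurable_rnDeriv P Q).pow_const α).aemeasurable]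
  refine lintegral_congr_ae ?_
  filter_upwards [Measure.rnDeriv_mul_rnDeriv (κ := P + Q) hPQ] with x hx
  rw [← hx, Pi.mul_apply, ENNReal.mul_rpow_of_nonneg _ _ hα0.le, mul_assoc,
    ← ENNReal.rpow_add_of_nonneg _ _ hα0.le (by linarith)]
  simp [mul_comm]

lemma kk_hell_symm {X : Type*} [MeasurableSpace X] (α : ℝ) (P Q : Measure X) :
    hellingerInt (1 - α) Q P = hellingerInt α P Q := by
  simp only [hellingerInt, add_comm Q P, sub_sub_cancel]
  exact lintegral_congr fun x => mul_comm _ _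

lemma kk_hell_le {X : Type*} [MeasurableSpace X] (α : ℝ) (hα0 : 0 < α) (hα1 : α < 1)
    (P Q : Measure X) [IsProbabilityMeasure P] [IsProbabilityMeasure Q] (hPQ : P ≪ Q) :
    hellingerInt α P Q ≤ 1 := by
  rw [kk_hell_eq α hα0 hα1 P Q hPQ]
  have := ENNReal.lintegral_mul_norm_pow_le (μ := Q)
    (Measure.measurable_rnDeriv P Q).aemeasurable (g := fun _ => 1) aemeasurable_const
    hα0.le (q := 1 - α) (by linarith) (by ring)
  simpa [Measure.lintegral_rnDeriv hPQ] using this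

lemma kk_hell_ne_zero {X : Type*} [MeasurableSpace X] (α : ℝ) (hα0 : 0 < α) (hα1 : α < 1)
    (P Q : Measure X) [IsProbabilityMeasure P] [IsProbabilityMeasure Q] (hPQ : P ≪ Q) :
    hellingerInt α P Q ≠ 0 := by
  rw [kk_hell_eq α hα0 hα1 P Q hPQ]
  intro h
  rw [lintegral_eq_zero_iff ((Measure.measurable_rnDeriv P Q).pow_const α)] at h
  have h2 : ∫⁻ x, P.rnDeriv Q x ∂Q = 0 := by
    rw [lintegral_eq_zero_iff (Measure.measurable_rnDeriv P Q)]
    filter_upwards [h] with x hx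
    simpa [hα0, hα0.le, not_lt.2 hα0.le] using hx
  rw [Measure.lintegral_rnDeriv hPQ] at h2
  simp at h2

/-- real-valued divergence -/
lemma kk_exists_d {X : Type*} [MeasurableSpace X] (α : ℝ) (hα0 : 0 < α) (hα1 : α < 1)
    (P Q : Measure X) [IsProbabilityMeasure P] [IsProbabilityMeasure Q] (hPQ : P ≪ Q) :
    ∃ d : ℝ, 0 ≤ d ∧ hellingerInt α P Q = ENNReal.ofReal (Real.exp (-(1 - α) * d)) ∧
      erealToENNReal (renyiSimple α P Q) = ENNReal.ofReal d := by
  have h1 := kk_hell_le α hα0 hα1 P Q hPQ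
  have h0 := kk_hell_ne_zero α hα0 hα1 P Q hPQ
  have ht : hellingerInt α P Q ≠ ⊤ := ne_top_of_le_ne_top ENNReal.one_ne_top h1
  set r := (hellingerInt α P Q).toReal with hr
  have hr0 : 0 < r := ENNReal.toReal_pos h0 ht
  have hr1 : r ≤ 1 := by
    have := ENNReal.toReal_mono ENNReal.one_ne_top h1
    simpa using this
  have hne : 1 - α ≠ 0 := by linarith
  refine ⟨(α - 1)⁻¹ * Real.log r, ?_, ?_, ?_⟩
  · exact mul_nonneg_of_nonpos_of_nonpos (inv_nonpos.2 (by linarith)) (Real.log_nonpos hr0.le hr1)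
  · have : -(1 - α) * ((α - 1)⁻¹ * Real.log r) = Real.log r := by
      have : α - 1 ≠ 0 := by linarith
      field_simp
      ring
    rw [this, Real.exp_log hr0, hr, ENNReal.ofReal_toReal ht]
  · have hl : ENNReal.log (hellingerInt α P Q) = ((Real.log r : ℝ) : EReal) := by
      rw [ENNReal.log_pos_real h0 ht]
    rw [renyiSimple, hl, ← EReal.coe_mul, erealToENNReal, if_neg (EReal.coe_ne_top _),
      EReal.toReal_coe]

section prod
variable {X : ℕ → Type*} [∀ n, MeasurableSpace (X n)]

lemma kk_lintegral_prod (Q : ∀ n, Measure (X n)) [∀ n, IsProbabilityMeasure (Q n)]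
    (s : Finset ℕ) (g : ∀ n, X n → ℝ≥0∞) (hg : ∀ n, Measurable (g n)) :
    ∫⁻ x, ∏ i ∈ s, g i (x i) ∂(Measure.infinitePi Q) = ∏ i ∈ s, ∫⁻ y, g i y ∂(Q i) := by
  rw [ProbabilityTheory.lintegral_prod_eq_prod_lintegral_of_indepFun s
    (fun i (x : ∀ n, X n) => g i (x i))
    (ProbabilityTheory.iIndepFun_infinitePi hg) (fun i => (hg i).comp (measurable_pi_apply i))]
  refine Finset.prod_congr rfl fun i _ => ?_
  rw [← Measure.infinitePi_map_eval Q i, lintegral_map (hg i) (measurable_pi_apply i)]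

lemma kk_withDensity (P Q : ∀ n, Measure (X n))
    [∀ n, IsProbabilityMeasure (P n)] [∀ n, IsProbabilityMeasure (Q n)]
    (hPQ : ∀ n, P n ≪ Q n) (F : Finset ℕ) (R : ∀ n, Measure (X n))
    [∀ n, IsProbabilityMeasure (R n)] (hR : ∀ n, R n = if n ∈ F then P n else Q n) :
    (Measure.infinitePi Q).withDensity (fun x => ∏ n ∈ F, (P n).rnDeriv (Q n) (x n))
      = Measure.infinitePi R := by
  refine Measure.eq_infinitePi _ fun s t ht => ?_
  have hm : MeasurableSet (Set.pi (s : Set ℕ) t) := MeasurableSet.pi s.countable_toSet fun i _ => ht i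
  rw [withDensity_apply _ hm, ← lintegral_indicator hm]
  let g : ∀ n, X n → ℝ≥0∞ := fun n y =>
    (if n ∈ s then (t n).indicator 1 y else 1) * (if n ∈ F then (P n).rnDeriv (Q n) y else 1)
  have hg : ∀ n, Measurable (g n) := by
    intro n
    refine Measurable.mul ?_ ?_
    · split_ifs
      · exact measurable_one.indicator (ht n)
      · exact measurable_const
    · split_ifs
      · exact Measure.measurable_rnDeriv _ _
      · exact measurable_const
  have h1 : ∀ x : ∀ n, X n, (Set.pi (s : Set ℕ) t).indicator
      (fun x => ∏ n ∈ F, (P n).rnDeriv (Q n) (x n)) x = ∏ n ∈ s ∪ F, g n (x n) := by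
    intro x
    simp only [g, Finset.prod_mul_distrib]
    rw [Finset.prod_ite_mem, Finset.prod_ite_mem, Finset.union_inter_cancel_left,
      Finset.union_inter_cancel_right]
    by_cases hx : x ∈ Set.pi (s : Set ℕ) t
    · rw [indicator_of_mem hx, Finset.prod_eq_one (s := s), one_mul]
      intro i hi
      simp [hx i hi]
    · rw [indicator_of_notMem hx]
      simp only [Set.mem_pi, not_forall] at hx
      obtain ⟨i, hi, hit⟩ := hx
      rw [Finset.prod_eq_zero (i := i) (by simpa using hi) (by simp [hit]), zero_mul]
  simp_rw [h1]
  rw [kk_lintegral_prod Q _ g hg]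
  have h2 : ∀ n, ∫⁻ y, g n y ∂(Q n) = if n ∈ s then R n (t n) else 1 := by
    intro n
    have hw : ∀ u, MeasurableSet u → ∫⁻ y, u.indicator 1 y * (P n).rnDeriv (Q n) y ∂(Q n)
        = P n u := by
      intro u hu
      simp_rw [← indicator_mul_left]
      simp only [Pi.one_apply, one_mul]
      rw [lintegral_indicator hu, Measure.setLIntegral_rnDeriv (hPQ n)]
    rw [hR n]
    by_cases hs : n ∈ s <;> by_cases hF : n ∈ F <;> simp only [g, hs, hF, if_true, if_false, mul_one,
      one_mul]
    · exact hw _ (ht n)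
    · rw [lintegral_indicator_one (ht n)]
    · rw [Measure.lintegral_rnDeriv (hPQ n)]; simp
    · simp
  simp_rw [h2]
  rw [Finset.prod_ite_mem, Finset.union_inter_cancel_left]

lemma kk_mix_prob (P Q : ∀ n, Measure (X n))
    [∀ n, IsProbabilityMeasure (P n)] [∀ n, IsProbabilityMeasure (Q n)] (F : Finset ℕ) (n : ℕ) :
    IsProbabilityMeasure (if n ∈ F then P n else Q n) := by
  split_ifs <;> infer_instance

lemma kk_cyl (P Q : ∀ n, Measure (X n))
    [∀ n, IsProbabilityMeasure (P n)] [∀ n, IsProbabilityMeasure (Q n)]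
    (hPQ : ∀ n, P n ≪ Q n) (F I : Finset ℕ) (hI : I ⊆ F) (S : Set (∀ i : I, X i))
    (hS : MeasurableSet S) :
    ∫⁻ x in cylinder I S, ∏ n ∈ F, (P n).rnDeriv (Q n) (x n) ∂(Measure.infinitePi Q)
      = Measure.infinitePi P (cylinder I S) := by
  have := kk_mix_prob P Q F
  rw [← withDensity_apply _ (hS.cylinder I), kk_withDensity P Q hPQ F _ (fun n => rfl),
    Measure.infinitePi_cylinder _ hS, Measure.infinitePi_cylinder _ hS]
  congr 2
  funext i
  simp [hI i.2]

lemma kk_meas (P Q : ∀ n, Measure (X n)) (F : Finset ℕ) :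
    Measurable (fun x : ∀ n, X n => ∏ n ∈ F, (P n).rnDeriv (Q n) (x n)) :=
  Finset.measurable_prod _ fun i _ =>
    (Measure.measurable_rnDeriv (P i) (Q i)).comp (measurable_pi_apply i)

lemma kk_ac (P Q : ∀ n, Measure (X n))
    [∀ n, IsProbabilityMeasure (P n)] [∀ n, IsProbabilityMeasure (Q n)]
    (hPQ : ∀ n, P n ≪ Q n) (α : ℝ) (hα0 : 0 < α) (hα1 : α < 1)
    (H : ∀ c < (1 : ℝ≥0∞), ∃ M, ∀ N, M ≤ N → c ≤ ∏ n ∈ Finset.Ico M N, hellingerInt α (P n) (Q n)) :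
    Measure.infinitePi P ≪ Measure.infinitePi Q := by
  refine Measure.AbsolutelyContinuous.mk fun A hA hQA => ?_
  have key : ∀ c < (1 : ℝ≥0∞), c ≤ (Measure.infinitePi P Aᶜ) ^ α := by
    intro c hc
    obtain ⟨M, hM⟩ := H c hc
    have := kk_mix_prob P Q (Finset.range M)
    set P' := Measure.infinitePi (fun n => if n ∈ Finset.range M then P n else Q n) with hP'
    have hd := kk_withDensity P Q hPQ (Finset.range M) _ (fun n => rfl)
    have hP'A : P' A = 0 := by
      rw [hP', ← hd]
      exact withDensity_absolutelyContinuous _ _ hQA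
    -- Hölder on cylinders
    have hcyl : ∀ B ∈ measurableCylinders X,
        c ≤ (Measure.infinitePi P B) ^ α * (P' B) ^ (1 - α)
          + (Measure.infinitePi P Bᶜ) ^ α * (P' Bᶜ) ^ (1 - α) := by
      intro B hB
      obtain ⟨I, S, hS, rfl⟩ := (mem_measurableCylinders B).1 hB
      obtain ⟨N, hMN, hIN⟩ : ∃ N, M ≤ N ∧ I ⊆ Finset.range N := by
        obtain ⟨K, hK⟩ := I.exists_nat_subset_range
        exact ⟨max M K, le_max_left _ _, hK.trans (Finset.range_subset_range.2 (le_max_right _ _))⟩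
      have hold : ∀ S : Set (∀ i : I, X i), MeasurableSet S →
          ∫⁻ x in cylinder I S, (∏ n ∈ Finset.range N, (P n).rnDeriv (Q n) (x n)) ^ α *
            (∏ n ∈ Finset.range M, (P n).rnDeriv (Q n) (x n)) ^ (1 - α) ∂(Measure.infinitePi Q)
          ≤ (Measure.infinitePi P (cylinder I S)) ^ α * (P' (cylinder I S)) ^ (1 - α) := by
        intro S hS
        rw [← kk_cyl P Q hPQ (Finset.range N) I hIN S hS, hP', ← hd,
          withDensity_apply _ (hS.cylinder I)]
        exact ENNReal.lintegral_mul_norm_pow_le (kk_meas P Q _).aemeasurable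
          (kk_meas P Q _).aemeasurable hα0.le (by linarith) (by ring)
      have h1 := hold S hS
      have h2 := hold Sᶜ hS.compl
      rw [← compl_cylinder] at h2
      refine le_trans ?_ (add_le_add h1 h2)
      rw [lintegral_add_compl _ (hS.cylinder I)]
      refine (hM N hMN).trans (le_of_eq ?_)
      let g : ∀ n, X n → ℝ≥0∞ := fun n y =>
        if n ∈ Finset.range M then (P n).rnDeriv (Q n) y else (P n).rnDeriv (Q n) y ^ α
      have hg : ∀ n, Measurable (g n) := by
        intro n
        simp only [g]
        split_ifs
        · exact Measure.measurable_rnDeriv _ _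
        · exact (Measure.measurable_rnDeriv _ _).pow_const _
      have h3 : ∀ x : ∀ n, X n, (∏ n ∈ Finset.range N, (P n).rnDeriv (Q n) (x n)) ^ α *
            (∏ n ∈ Finset.range M, (P n).rnDeriv (Q n) (x n)) ^ (1 - α)
            = ∏ n ∈ Finset.range N, g n (x n) := by
        intro x
        rw [← ENNReal.prod_rpow_of_nonneg hα0.le, ← ENNReal.prod_rpow_of_nonneg (by linarith),
          ← Finset.prod_range_mul_prod_Ico _ hMN, ← Finset.prod_range_mul_prod_Ico _ hMN,
          mul_right_comm, ← Finset.prod_mul_distrib]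
        congr 1
        · refine Finset.prod_congr rfl fun i hi => ?_
          simp only [g, hi, if_true]
          rw [← ENNReal.rpow_add_of_nonneg _ _ hα0.le (by linarith)]
          simp
        · refine Finset.prod_congr rfl fun i hi => ?_
          have : i ∉ Finset.range M := by
            simp only [Finset.mem_Ico, Finset.mem_range] at hi ⊢; omega
          simp only [g, this, if_false]
      simp_rw [h3]
      rw [kk_lintegral_prod Q _ g hg, ← Finset.prod_range_mul_prod_Ico _ hMN,
        Finset.prod_eq_one (s := Finset.range M), one_mul]
      · refine Finset.prod_congr rfl fun i hi => ?_
        have : i ∉ Finset.range M := by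
          simp only [Finset.mem_Ico, Finset.mem_range] at hi ⊢; omega
        simp only [g, this, if_false]
        exact kk_hell_eq α hα0 hα1 _ _ (hPQ i)
      · intro i hi
        simp only [g, hi, if_true]
        rw [Measure.lintegral_rnDeriv (hPQ i)]; simp
    have hδ : ∀ δ : ℝ≥0∞, 0 < δ → c ≤ δ ^ (1 - α) + (Measure.infinitePi P Aᶜ + δ) ^ α := by
      intro δ hδ
      obtain ⟨B, hB, hBA⟩ := exists_measure_symmDiff_lt_of_generateFrom_isSetRing
        (μ := Measure.infinitePi P + P') (C := measurableCylinders X) isSetRing_measurableCylinders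
        ⟨{univ}, by simp, by simpa using univ_mem_measurableCylinders X, by simp⟩
        generateFrom_measurableCylinders.symm hA hδ
      rw [Measure.add_apply] at hBA
      have b1 : P' B ≤ δ := by
        calc P' B ≤ P' (A ∪ symmDiff B A) := measure_mono (by
              intro x hx
              by_cases hxA : x ∈ A
              · exact Or.inl hxA
              · exact Or.inr (Or.inl ⟨hx, hxA⟩))
          _ ≤ P' A + P' (symmDiff B A) := measure_union_le _ _
          _ ≤ δ := by rw [hP'A, zero_add]; exact le_add_self.trans hBA.le
      have b2 : Measure.infinitePi P Bᶜ ≤ Measure.infinitePi P Aᶜ + δ := by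
        calc Measure.infinitePi P Bᶜ ≤ Measure.infinitePi P (Aᶜ ∪ symmDiff B A) :=
              measure_mono (by
              intro x hx
              by_cases hxA : x ∈ A
              · exact Or.inr (Or.inr ⟨hxA, hx⟩)
              · exact Or.inl hxA)
          _ ≤ Measure.infinitePi P Aᶜ + Measure.infinitePi P (symmDiff B A) := measure_union_le _ _
          _ ≤ _ := by gcongr; exact le_self_add.trans hBA.le
      have h1α : 0 ≤ 1 - α := by linarith
      refine (hcyl B hB).trans (add_le_add ?_ ?_)
      · calc _ ≤ (1 : ℝ≥0∞) ^ α * δ ^ (1 - α) := by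
              gcongr
              exact prob_le_one
          _ = _ := by simp
      · calc _ ≤ (Measure.infinitePi P Aᶜ + δ) ^ α * (1 : ℝ≥0∞) ^ (1 - α) := by
              gcongr
              exact prob_le_one
          _ = _ := by simp
    have hlim : Tendsto (fun k : ℕ => ((k : ℝ≥0∞)⁻¹) ^ (1 - α)
        + (Measure.infinitePi P Aᶜ + (k : ℝ≥0∞)⁻¹) ^ α) atTop
        (𝓝 ((0 : ℝ≥0∞) ^ (1 - α) + (Measure.infinitePi P Aᶜ + 0) ^ α)) := by
      have h0 := ENNReal.tendsto_inv_nat_nhds_zero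
      exact (h0.ennrpow_const _).add ((tendsto_const_nhds.add h0).ennrpow_const _)
    have := ge_of_tendsto' hlim (fun k => hδ _ (by simp))
    rwa [ENNReal.zero_rpow_of_pos (by linarith), zero_add, add_zero] at this
  have h1 : 1 ≤ (Measure.infinitePi P Aᶜ) ^ α := le_of_forall_lt fun c hc => by
    obtain ⟨c', h, h'⟩ := exists_between hc
    exact h.trans_le (key c' h')
  have h2 : Measure.infinitePi P Aᶜ = 1 := by
    refine le_antisymm prob_le_one ?_
    by_contra hlt
    exact absurd h1 (not_le.2 (ENNReal.rpow_lt_one (not_le.1 hlt) hα0))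
  rwa [prob_compl_eq_one_iff hA] at h2

lemma kk_sing (P Q : ∀ n, Measure (X n))
    [∀ n, IsProbabilityMeasure (P n)] [∀ n, IsProbabilityMeasure (Q n)]
    (hPQ : ∀ n, P n ≪ Q n) (α : ℝ) (hα0 : 0 < α) (hα1 : α < 1)
    (H : ∀ c > (0 : ℝ≥0∞), ∃ N, ∏ n ∈ Finset.range N, hellingerInt α (P n) (Q n) ≤ c) :
    Measure.MutuallySingular (Measure.infinitePi P) (Measure.infinitePi Q) := by
  have step : ∀ c > (0 : ℝ≥0∞), ∃ B, MeasurableSet B ∧ Measure.infinitePi P B ≤ c ∧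
      Measure.infinitePi Q Bᶜ ≤ c := by
    intro c hc
    obtain ⟨N, hN⟩ := H c hc
    have hint : ∫⁻ x, (∏ n ∈ Finset.range N, (P n).rnDeriv (Q n) (x n)) ^ α
        ∂(Measure.infinitePi Q) ≤ c := by
      refine le_trans (le_of_eq ?_) hN
      simp_rw [← ENNReal.prod_rpow_of_nonneg hα0.le]
      rw [kk_lintegral_prod Q _ (fun n y => (P n).rnDeriv (Q n) y ^ α)
        (fun n => (Measure.measurable_rnDeriv _ _).pow_const _)]
      exact Finset.prod_congr rfl fun i _ => (kk_hell_eq α hα0 hα1 _ _ (hPQ i)).symm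
    -- the set is a cylinder
    let I := Finset.range N
    let S : Set (∀ i : I, X i) := {y | ∏ i : I, (P i).rnDeriv (Q i) (y i) < 1}
    have hS : MeasurableSet S := by
      refine measurableSet_lt ?_ measurable_const
      exact Finset.measurable_prod _ fun i _ =>
        (Measure.measurable_rnDeriv (P i) (Q i)).comp (measurable_pi_apply i)
    have hmem : ∀ x, x ∈ cylinder I S ↔ ∏ n ∈ I, (P n).rnDeriv (Q n) (x n) < 1 := by
      intro x
      rw [mem_cylinder, ← Finset.prod_coe_sort]
      rfl
    refine ⟨cylinder I S, hS.cylinder I, ?_, ?_⟩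
    · rw [← kk_cyl P Q hPQ I I subset_rfl S hS]
      refine le_trans ?_ hint
      refine le_trans (setLIntegral_mono' (hS.cylinder I) fun x hx => ?_)
        (setLIntegral_le_lintegral (cylinder I S) _)
      have := (hmem x).1 hx
      simpa using ENNReal.rpow_le_rpow_of_exponent_ge this.le hα1.le
    · refine le_trans ?_ hint
      rw [← setLIntegral_one]
      refine le_trans (setLIntegral_mono' (hS.cylinder I).compl fun x hx => ?_)
        (setLIntegral_le_lintegral (cylinder I S)ᶜ _)
      have : 1 ≤ ∏ n ∈ I, (P n).rnDeriv (Q n) (x n) := by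
        by_contra h
        exact hx ((hmem x).2 (not_le.1 h))
      exact ENNReal.one_le_rpow this hα0
  have hε : ∀ n : ℕ, ((2 : ℝ≥0∞)⁻¹) ^ n > 0 := fun n => by
    apply ENNReal.pow_pos; simp
  choose B hBm hBP hBQ using fun n : ℕ => step _ (hε n)
  have hsum : ∑' n : ℕ, ((2 : ℝ≥0∞)⁻¹) ^ n ≠ ⊤ := by
    rw [ENNReal.tsum_geometric]; simp
  have l1 := measure_limsup_atTop_eq_zero (μ := Measure.infinitePi P) (s := B)
    (ne_top_of_le_ne_top hsum (ENNReal.tsum_le_tsum hBP))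
  have l2 := measure_limsup_atTop_eq_zero (μ := Measure.infinitePi Q) (s := fun n => (B n)ᶜ)
    (ne_top_of_le_ne_top hsum (ENNReal.tsum_le_tsum hBQ))
  refine Measure.MutuallySingular.mk l1 l2 fun x _ => ?_
  rw [Set.mem_union, mem_limsup_iff_frequently_mem, mem_limsup_iff_frequently_mem,
    ← Filter.frequently_or_distrib]
  exact (Filter.Eventually.of_forall fun n => em (x ∈ B n)).frequently

lemma kk_eq_infinitePi (P : ∀ n, Measure (X n)) [∀ n, IsProbabilityMeasure (P n)]
    (Pinf : Measure (∀ n, X n))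
    (hPinf : ∀ N : ℕ, Measure.map (fun x (i : Fin N) => x i) Pinf
      = Measure.pi fun i : Fin N => P i) : Pinf = Measure.infinitePi P := by
  refine Measure.eq_infinitePi _ fun s t ht => ?_
  obtain ⟨N, hN⟩ := s.exists_nat_subset_range
  let u : ∀ n, Set (X n) := fun n => if n ∈ s then t n else univ
  have hu : ∀ n, MeasurableSet (u n) := by
    intro n; simp only [u]; split_ifs
    · exact ht n
    · exact .univ
  have hpre : Set.pi (s : Set ℕ) t = (fun (x : ∀ n, X n) (i : Fin N) => x i) ⁻¹'
      (Set.pi univ fun i : Fin N => u i) := by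
    ext x
    simp only [Set.mem_pi, Set.mem_preimage, Set.mem_univ, true_imp_iff, u, Finset.mem_coe]
    constructor
    · intro h i
      split_ifs with hi
      · exact h _ hi
      · trivial
    · intro h i hi
      have := h ⟨i, Finset.mem_range.1 (hN hi)⟩
      simpa [hi] using this
  rw [hpre, ← Measure.map_apply (by fun_prop) (MeasurableSet.univ_pi fun i : Fin N => hu i), hPinf N,
    Measure.pi_pi, Fin.prod_univ_eq_prod_range (fun n => P n (u n)) N]
  have : ∀ n, P n (u n) = if n ∈ s then P n (t n) else 1 := by
    intro n; simp only [u]; split_ifs <;> simp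
  simp_rw [this]
  rw [Finset.prod_ite_mem, Finset.inter_eq_right.2 hN]

end prod

/-- **Kakutani's dichotomy.** Let `α ∈ (0,1)` and let `Pinf = P 0 × P 1 × ⋯` and
`Qinf = Q 0 × Q 1 × ⋯` be infinite products (characterized by their finite-dimensional
marginals) of probability measures with `P n` and `Q n` equivalent for every `n`.  Then
`Pinf` and `Qinf` are equivalent iff `∑ₙ D_α(P n ‖ Q n) < ∞`, and mutually singular iff
`∑ₙ D_α(P n ‖ Q n) = ∞`. -/
theorem kakutani_dichotomy
    {X : ℕ → Type*} [∀ n, MeasurableSpace (X n)]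
    (P Q : ∀ n, Measure (X n))
    [∀ n, IsProbabilityMeasure (P n)] [∀ n, IsProbabilityMeasure (Q n)]
    (hPQ : ∀ n, P n ≪ Q n) (hQP : ∀ n, Q n ≪ P n)
    (α : ℝ) (hα0 : 0 < α) (hα1 : α < 1)
    (Pinf Qinf : Measure (∀ n, X n))
    [IsProbabilityMeasure Pinf] [IsProbabilityMeasure Qinf]
    (hPinf : ∀ N : ℕ, Measure.map (fun x (i : Fin N) => x i) Pinf
      = Measure.pi fun i : Fin N => P i)
    (hQinf : ∀ N : ℕ, Measure.map (fun x (i : Fin N) => x i) Qinf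
      = Measure.pi fun i : Fin N => Q i) :
    ((Pinf ≪ Qinf ∧ Qinf ≪ Pinf) ↔
      ∑' n : ℕ, erealToENNReal (renyiSimple α (P n) (Q n)) < ⊤) ∧
    (Measure.MutuallySingular Pinf Qinf ↔
      ∑' n : ℕ, erealToENNReal (renyiSimple α (P n) (Q n)) = ⊤) := by
  obtain rfl := kk_eq_infinitePi P Pinf hPinf
  obtain rfl := kk_eq_infinitePi Q Qinf hQinf
  choose d hd0 hdh hdD using fun n => kk_exists_d α hα0 hα1 (P n) (Q n) (hPQ n)
  have hb : 0 < 1 - α := by linarith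
  have hprod : ∀ s : Finset ℕ, ∏ n ∈ s, hellingerInt α (P n) (Q n)
      = ENNReal.ofReal (Real.exp (-(1 - α) * ∑ n ∈ s, d n)) := by
    intro s
    rw [Finset.mul_sum, Real.exp_sum, ENNReal.ofReal_prod_of_nonneg (fun i _ => (Real.exp_pos _).le)]
    exact Finset.prod_congr rfl fun i _ => hdh i
  simp_rw [hdD]
  have hA : ∑' n : ℕ, ENNReal.ofReal (d n) < ⊤ →
      (Measure.infinitePi P ≪ Measure.infinitePi Q ∧
        Measure.infinitePi Q ≪ Measure.infinitePi P) := by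
    intro hs
    have hsum : Summable d := by
      have := ENNReal.summable_toReal hs.ne
      simpa [ENNReal.toReal_ofReal, hd0] using this
    have H : ∀ c < (1 : ℝ≥0∞), ∃ M, ∀ N, M ≤ N →
        c ≤ ∏ n ∈ Finset.Ico M N, hellingerInt α (P n) (Q n) := by
      intro c hc
      have hlim : Tendsto (fun M => ENNReal.ofReal (Real.exp (-(1 - α) * ∑' k, d (k + M)))) atTop
          (𝓝 1) := by
        have h1 := (tendsto_sum_nat_add d).const_mul (-(1 - α))
        have h2 := ENNReal.tendsto_ofReal ((Real.continuous_exp.tendsto _).comp h1)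
        simpa using h2
      obtain ⟨M, hM⟩ := (hlim.eventually (lt_mem_nhds hc)).exists
      refine ⟨M, fun N hMN => hM.le.trans ?_⟩
      rw [hprod]
      refine ENNReal.ofReal_le_ofReal (Real.exp_le_exp.2 ?_)
      have : ∑ n ∈ Finset.Ico M N, d n ≤ ∑' k, d (k + M) := by
        rw [Finset.sum_Ico_eq_sum_range]
        simp_rw [add_comm M]
        exact ((summable_nat_add_iff M).2 hsum).sum_le_tsum _ fun i _ => hd0 _
      nlinarith
    refine ⟨kk_ac P Q hPQ α hα0 hα1 H, kk_ac Q P hQP (1 - α) hb (by linarith) ?_⟩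
    simpa only [kk_hell_symm] using H
  have hB : ∑' n : ℕ, ENNReal.ofReal (d n) = ⊤ →
      Measure.MutuallySingular (Measure.infinitePi P) (Measure.infinitePi Q) := by
    intro hs
    refine kk_sing P Q hPQ α hα0 hα1 fun c hc => ?_
    have hns : ¬ Summable d := fun h => h.tsum_ofReal_ne_top hs
    have ht := (not_summable_iff_tendsto_nat_atTop_of_nonneg hd0).1 hns
    have h1 : Tendsto (fun N => -(1 - α) * ∑ n ∈ Finset.range N, d n) atTop atBot :=
      ht.const_mul_atTop_of_neg (by linarith)
    have h2 := ENNReal.tendsto_ofReal (Real.tendsto_exp_atBot.comp h1)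
    rw [ENNReal.ofReal_zero] at h2
    obtain ⟨N, hN⟩ := (h2.eventually (gt_mem_nhds hc)).exists
    exact ⟨N, by rw [hprod]; exact hN.le⟩
  have hC : (Measure.infinitePi P ≪ Measure.infinitePi Q) →
      ¬ Measure.MutuallySingular (Measure.infinitePi P) (Measure.infinitePi Q) := by
    intro hac hms
    have := Measure.eq_zero_of_absolutelyContinuous_of_mutuallySingular hac hms
    exact IsProbabilityMeasure.ne_zero _ this
  refine ⟨⟨fun h => ?_, hA⟩, ⟨fun h => ?_, hB⟩⟩
  · by_contra hne
    exact hC h.1 (hB (not_lt_top_iff.1 hne))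
  · by_contra hne
    exact hC (hA (lt_top_iff_ne_top.2 hne)).1 h
end
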